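/- arXiv:1403.2283 — 6 statements merged into one kernel-verified Lean document; each statement's English description precedes it below -/
import Mathlib

section
/- Stroh's formula: let R be a commutative ring and u₁, u₂, u₃ ∈ R with u₁ + u₂ + u₃ = 0. Let k₁, k₂, k₃ be nonnegative integers and g := k₁ + k₂ + k₃ + 1. Then (−1)^{k₂} Σ_{i=0}^{k₁} C(g,i)·C(k₁+k₃−i, k₃)·u₃^{g−i}·u₁^{i} + (−1)^{k₃} Σ_{i=0}^{k₂} C(g,i)·C(k₂+k₁−i, k₁)·u₁^{g−i}·u₂^{i} + (−1)^{k₁} Σ_{i=0}^{k₃} C(g,i)·C(k₃+k₂−i, k₂)·u₂^{g−i}·u₃^{i} = 0. -/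
open PowerSeries in
/-- The coefficient of `X ^ a` in `X (y + x X) ^ g / (1 - X) ^ b`, i.e. the residue at `0` of
`(y + x t) ^ g / (t ^ a (1 - t) ^ b)`. -/
noncomputable def strohResidue {R : Type*} [CommRing R] (x y : R) (a b g : ℕ) : R :=
  coeff a (X * ((C y + C x * X) ^ g * (mk 1 : R⟦X⟧) ^ b))

namespace strohResidue

variable {R : Type*} [CommRing R] (x y : R)

open PowerSeries

theorem zero_left (b g : ℕ) : strohResidue x y 0 b g = 0 := by
  simp [strohResidue]

theorem coeff_linear_pow (g i : ℕ) :
    coeff i ((C y + C x * X : R⟦X⟧) ^ g) = (g.choose i : R) * y ^ (g - i) * x ^ i := by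
  induction g generalizing i with
  | zero => cases i <;> simp [coeff_one]
  | succ g ih =>
    rw [pow_succ', add_mul, mul_assoc, map_add, coeff_C_mul, coeff_C_mul, ih]
    cases i with
    | zero => simp [pow_succ']
    | succ i =>
      rw [coeff_succ_X_mul, ih, Nat.choose_succ_succ, Nat.add_sub_add_right]
      rcases Nat.lt_or_ge i g with hi | hi
      · obtain ⟨m, rfl⟩ := Nat.exists_eq_add_of_lt hi
        rw [show i + m + 1 - (i + 1) = m by omega, show i + m + 1 - i = m + 1 by omega]
        push_cast
        ring
      · rw [Nat.choose_eq_zero_of_lt (Nat.lt_succ_of_le hi)]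
        push_cast
        ring

theorem eq_sum (k l g : ℕ) :
    strohResidue x y (k + 1) (l + 1) g =
      ∑ i ∈ Finset.range (k + 1),
        (g.choose i : R) * ((k + l - i).choose l : R) * y ^ (g - i) * x ^ i := by
  rw [strohResidue, coeff_succ_X_mul, coeff_mul, mk_one_pow_eq_mk_choose_add,
    Finset.Nat.sum_antidiagonal_eq_sum_range_succ_mk]
  refine Finset.sum_congr rfl fun i hi => ?_
  have hi' : i ≤ k := Nat.lt_succ_iff.mp (Finset.mem_range.mp hi)
  rw [coeff_linear_pow, coeff_mk, show l + (k - i) = k + l - i by omega]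
  ring

theorem eq_zero_of_lt {a g : ℕ} (h : g < a) : strohResidue x y (a + 1) 0 g = 0 := by
  rw [strohResidue, coeff_succ_X_mul, pow_zero, mul_one, coeff_linear_pow,
    Nat.choose_eq_zero_of_lt h]
  simp

theorem succ_degree (a b g : ℕ) :
    strohResidue x y (a + 1) b (g + 1) =
      y * strohResidue x y (a + 1) b g + x * strohResidue x y a b g := by
  simp only [strohResidue]
  rw [← coeff_C_mul, ← coeff_C_mul, ← coeff_succ_X_mul a, ← map_add]
  congr 1
  ring

theorem succ_succ (a b g : ℕ) :
    strohResidue x y (a + 1) (b + 1) g =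
      strohResidue x y (a + 1) b g + strohResidue x y a (b + 1) g := by
  simp only [strohResidue]
  rw [← coeff_succ_X_mul a, ← map_add]
  congr 1
  have h := mk_one_mul_one_sub_eq_one R
  linear_combination (X * ((C y + C x * X) ^ g * (mk 1 : R⟦X⟧) ^ b)) * h

theorem succ_succ_degree (a b g : ℕ) :
    strohResidue x y (a + 1) (b + 1) (g + 1) =
      y * strohResidue x y (a + 1) b g + (x + y) * strohResidue x y a (b + 1) g := by
  rw [succ_degree, succ_succ]
  ring

theorem succ_right_degree (a b g : ℕ) :
    strohResidue x y a (b + 1) (g + 1) =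
      (x + y) * strohResidue x y a (b + 1) g - x * strohResidue x y a b g := by
  cases a with
  | zero => simp [zero_left]
  | succ a =>
    rw [succ_degree, succ_succ]
    ring

/-- The signed sum of the three residues, at `0`, `1` and `∞`. -/
noncomputable def total (u₁ u₂ u₃ : R) (a₁ a₂ a₃ g : ℕ) : R :=
  (-1) ^ a₂ * strohResidue u₁ u₃ a₁ a₃ g + (-1) ^ a₃ * strohResidue u₂ u₁ a₂ a₁ g +
    (-1) ^ a₁ * strohResidue u₃ u₂ a₃ a₂ g

theorem total_rotate (u₁ u₂ u₃ : R) (a₁ a₂ a₃ g : ℕ) :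
    total u₁ u₂ u₃ a₁ a₂ a₃ g = total u₂ u₃ u₁ a₂ a₃ a₁ g := by
  simp only [total]
  ring

theorem total_succ {u₁ u₂ u₃ : R} (h : u₁ + u₂ + u₃ = 0) (a₁ a₂ a₃ g : ℕ) :
    total u₁ u₂ u₃ (a₁ + 1) a₂ (a₃ + 1) (g + 1) =
      u₃ * total u₁ u₂ u₃ (a₁ + 1) a₂ a₃ g - u₂ * total u₁ u₂ u₃ a₁ a₂ (a₃ + 1) g := by
  obtain rfl : u₁ = -u₂ - u₃ := by linear_combination h
  simp only [total]
  rw [succ_succ_degree, succ_right_degree, succ_degree]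
  ring

theorem total_single (u₁ u₂ u₃ : R) (g : ℕ) : total u₁ u₂ u₃ (g + 2) 0 0 g = 0 := by
  simp [total, zero_left, eq_zero_of_lt]

theorem total_one_zero_one (u₁ u₂ u₃ : R) : total u₁ u₂ u₃ 1 0 1 0 = 0 := by
  have h₁ : strohResidue u₁ u₃ 1 1 0 = 1 := by simpa using eq_sum u₁ u₃ 0 0 0
  have h₂ : strohResidue u₃ u₂ 1 0 0 = 1 := by
    rw [strohResidue, coeff_succ_X_mul]
    simp
  simp [total, zero_left, h₁, h₂]

/-- The residue theorem on the projective line, for the poles `0`, `1` and `∞`. -/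
theorem total_eq_zero {u₁ u₂ u₃ : R} (h : u₁ + u₂ + u₃ = 0) {a₁ a₂ a₃ g : ℕ}
    (hg : a₁ + a₂ + a₃ = g + 2) : total u₁ u₂ u₃ a₁ a₂ a₃ g = 0 := by
  induction g generalizing u₁ u₂ u₃ a₁ a₂ a₃ with
  | zero =>
    have key : ∀ {v₁ v₂ v₃ : R} {b₁ b₂ b₃ : ℕ}, b₁ + b₂ + b₃ = 2 → b₂ = 0 → b₁ ≠ 0 →
        total v₁ v₂ v₃ b₁ b₂ b₃ 0 = 0 := by
      intro v₁ v₂ v₃ b₁ b₂ b₃ hb h₂ h₁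
      subst h₂
      obtain ⟨rfl, rfl⟩ | ⟨rfl, rfl⟩ : b₁ = 2 ∧ b₃ = 0 ∨ b₁ = 1 ∧ b₃ = 1 := by omega
      · exact total_single v₁ v₂ v₃ 0
      · exact total_one_zero_one v₁ v₂ v₃
    by_cases h₁ : a₂ = 0 ∧ a₁ ≠ 0
    · exact key hg h₁.1 h₁.2
    rw [total_rotate]
    by_cases h₂ : a₃ = 0 ∧ a₂ ≠ 0
    · exact key (by omega) h₂.1 h₂.2
    rw [total_rotate]
    exact key (by omega) (by omega) (by omega)
  | succ g ih =>
    have key : ∀ {v₁ v₂ v₃ : R} {b₁ b₂ b₃ : ℕ}, v₁ + v₂ + v₃ = 0 → b₁ + b₂ + b₃ = g + 3 →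
        b₁ ≠ 0 → (b₃ = 0 → b₂ = 0) → total v₁ v₂ v₃ b₁ b₂ b₃ (g + 1) = 0 := by
      intro v₁ v₂ v₃ b₁ b₂ b₃ hv hb h₁ h₃
      rcases b₃ with _ | b₃
      · obtain rfl := h₃ rfl
        obtain rfl : b₁ = g + 1 + 2 := by omega
        exact total_single v₁ v₂ v₃ (g + 1)
      · obtain ⟨b₁, rfl⟩ := Nat.exists_eq_succ_of_ne_zero h₁
        rw [Nat.succ_eq_add_one, total_succ hv, ih hv (by omega), ih hv (by omega)]
        ring
    by_cases h₁ : a₁ ≠ 0 ∧ (a₃ = 0 → a₂ = 0)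
    · exact key h hg h₁.1 h₁.2
    rw [total_rotate]
    by_cases h₂ : a₂ ≠ 0 ∧ (a₁ = 0 → a₃ = 0)
    · exact key (by linear_combination h) (by omega) h₂.1 h₂.2
    rw [total_rotate]
    exact key (by linear_combination h) (by omega) (by omega) (by omega)

end strohResidue

/-- **Stroh's formula.** Let `R` be a commutative ring and `u₁, u₂, u₃ ∈ R` with
`u₁ + u₂ + u₃ = 0`. Let `k₁, k₂, k₃` be nonnegative integers and
`g := k₁ + k₂ + k₃ + 1`. Then
`(−1)^{k₂} Σ_{i=0}^{k₁} C(g,i)·C(k₁+k₃−i, k₃)·u₃^{g−i}·u₁^{i}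
 + (−1)^{k₃} Σ_{i=0}^{k₂} C(g,i)·C(k₂+k₁−i, k₁)·u₁^{g−i}·u₂^{i}
 + (−1)^{k₁} Σ_{i=0}^{k₃} C(g,i)·C(k₃+k₂−i, k₂)·u₂^{g−i}·u₃^{i} = 0`. -/
theorem stroh_formula {R : Type*} [CommRing R] (u₁ u₂ u₃ : R)
    (h : u₁ + u₂ + u₃ = 0) (k₁ k₂ k₃ : ℕ) :
    (-1 : R) ^ k₂ *
        ∑ i ∈ Finset.range (k₁ + 1),
          ((k₁ + k₂ + k₃ + 1).choose i : R) * ((k₁ + k₃ - i).choose k₃ : R) *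
            u₃ ^ (k₁ + k₂ + k₃ + 1 - i) * u₁ ^ i +
      (-1 : R) ^ k₃ *
        ∑ i ∈ Finset.range (k₂ + 1),
          ((k₁ + k₂ + k₃ + 1).choose i : R) * ((k₂ + k₁ - i).choose k₁ : R) *
            u₁ ^ (k₁ + k₂ + k₃ + 1 - i) * u₂ ^ i +
      (-1 : R) ^ k₁ *
        ∑ i ∈ Finset.range (k₃ + 1),
          ((k₁ + k₂ + k₃ + 1).choose i : R) * ((k₃ + k₂ - i).choose k₂ : R) *
            u₂ ^ (k₁ + k₂ + k₃ + 1 - i) * u₃ ^ i = 0 := by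
  have key := strohResidue.total_eq_zero h
    (show (k₁ + 1) + (k₂ + 1) + (k₃ + 1) = (k₁ + k₂ + k₃ + 1) + 2 by omega)
  simp only [strohResidue.total, strohResidue.eq_sum] at key
  linear_combination -key
end

section
/- Plücker relation for Cayley and polarization operators: as ℂ-linear endomorphisms of the polynomial ring ℂ[x, y, x_α, y_α, x_β, y_β, x_γ, y_γ], one has Ω_{αβ}·σ_γ = Ω_{αγ}·σ_β + Ω_{γβ}·σ_α. -/
noncomputable section

open MvPolynomial

/-- The group `SL(2,ℂ)`. -/
abbrev SL2 : Type := Matrix.SpecialLinearGroup (Fin 2) ℂ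

/-- The polynomial ring `ℂ[x, y, x_α, y_α, …]` with `k` pairs of variables.
When relevant, the pair indexed by `0` is the main pair of variables `(x, y)`. -/
abbrev PRing (k : ℕ) : Type := MvPolynomial (Fin k × Fin 2) ℂ

/-- Partial derivative as a `ℂ`-linear endomorphism. -/
def pd {k : ℕ} (v : Fin k × Fin 2) : Module.End ℂ (PRing k) :=
  (pderiv v).toLinearMap

/-- The Cayley operator `Ω_{ab} := ∂²/(∂x_a ∂y_b) − ∂²/(∂y_a ∂x_b)`. -/
def Omega {k : ℕ} (a b : Fin k) : Module.End ℂ (PRing k) :=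
  pd (a, 0) * pd (b, 1) - pd (a, 1) * pd (b, 0)

/-- The polarization operator `σ_a := x·∂/∂x_a + y·∂/∂y_a`, where `(x,y)` is the
main pair of variables (the pair indexed by `0`). -/
def Sigma' {k : ℕ} [NeZero k] (a : Fin k) : Module.End ℂ (PRing k) :=
  (LinearMap.mulLeft ℂ (X ((0 : Fin k), (0 : Fin 2)) : PRing k) : Module.End ℂ (PRing k)) * pd (a, 0)
    + (LinearMap.mulLeft ℂ (X ((0 : Fin k), (1 : Fin 2)) : PRing k) : Module.End ℂ (PRing k)) * pd (a, 1)

/-- The action of `g ∈ SL(2,ℂ)` on `PRing k`, substituting every pair of variables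
by its image under `g⁻¹`. -/
def actP {k : ℕ} (g : SL2) : PRing k →ₐ[ℂ] PRing k :=
  aeval fun v => ∑ j : Fin 2, MvPolynomial.C ((g⁻¹).1 v.2 j) * X (v.1, j)

/-- Embedding `ℂ[x,y] → PRing 3` sending the variables to the pair indexed by `a`. -/
def embP (a : Fin 3) : MvPolynomial (Fin 2) ℂ →ₐ[ℂ] PRing 3 :=
  rename fun i => (a, i)

/-- The map `PRing 3 → ℂ[x,y]` restricting to the diagonal
`x_α = x_β = x`, `y_α = y_β = y`. -/
def toMain : PRing 3 →ₐ[ℂ] MvPolynomial (Fin 2) ℂ :=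
  aeval fun v => X v.2

/-- The transvectant `⟨f, h⟩_r` of binary forms of degrees `n` and `p`:
`⟨f,h⟩_r := Ω_{αβ}^r σ_α^{n−r} σ_β^{p−r} (f(x_α,y_α)·h(x_β,y_β))` when
`0 ≤ r ≤ min n p`, and `0` otherwise. -/
def transv (n p r : ℕ) (f h : MvPolynomial (Fin 2) ℂ) : MvPolynomial (Fin 2) ℂ :=
  if r ≤ min n p then
    toMain ((Omega 1 2 ^ r)
      ((Sigma' 1 ^ (n - r)) ((Sigma' 2 ^ (p - r)) (embP 1 f * embP 2 h))))
  else 0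

/-- The action of `g ∈ SL(2,ℂ)` on binary forms: `(g·f)(x) := f(g⁻¹·x)`. -/
def act2 (g : SL2) : MvPolynomial (Fin 2) ℂ →ₐ[ℂ] MvPolynomial (Fin 2) ℂ :=
  aeval fun i => ∑ j : Fin 2, MvPolynomial.C ((g⁻¹).1 i j) * X j

/-- Partial derivatives of polynomials commute. -/
theorem pd_comm {k : ℕ} (v w : Fin k × Fin 2) (F : PRing k) :
    pd v (pd w F) = pd w (pd v F) := by
  have h : ⁅(pderiv v : Derivation ℂ (PRing k) (PRing k)),
      (pderiv w : Derivation ℂ (PRing k) (PRing k))⁆ = 0 := by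
    refine derivation_ext fun u => ?_
    simp [Derivation.commutator_apply, pderiv_X, Pi.single_apply, apply_ite]
  have hF := congrArg (fun D : Derivation ℂ (PRing k) (PRing k) => D F) h
  simpa [Derivation.commutator_apply, sub_eq_zero, pd] using hF

/-- A partial derivative is linear over the other variables. -/
theorem pd_X_mul_of_ne {k : ℕ} {v w : Fin k × Fin 2} (h : w ≠ v) (F : PRing k) :
    pd v (X w * F) = X w * pd v F := by
  simp [pd, Derivation.leibniz, pderiv_X_of_ne h]

/-- The Cayley operator of two symbols is linear over the variables of any other pair. -/
theorem Omega_X_mul_of_ne {k : ℕ} {a b c : Fin k} (ha : c ≠ a) (hb : c ≠ b) (j : Fin 2)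
    (F : PRing k) : Omega a b (X (c, j) * F) = X (c, j) * Omega a b F := by
  have h (d : Fin k) (hd : c ≠ d) (i : Fin 2) (G : PRing k) :
      pd (d, i) (X (c, j) * G) = X (c, j) * pd (d, i) G :=
    pd_X_mul_of_ne (fun e => hd (congrArg Prod.fst e)) G
  simp only [Omega, LinearMap.sub_apply, Module.End.mul_apply, h a ha, h b hb, mul_sub]

/-- The Plücker relation between Cayley operators and the partial derivatives in the
`j`-th variable of each pair. -/
theorem Omega_pd_pluecker {k : ℕ} (a b c : Fin k) (j : Fin 2) (F : PRing k) :
    Omega a b (pd (c, j) F) = Omega a c (pd (b, j) F) + Omega c b (pd (a, j) F) := by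
  simp only [Omega, LinearMap.sub_apply, Module.End.mul_apply]
  fin_cases j <;> simp only [Fin.zero_eta, Fin.mk_one, pd_comm] <;> abel

/-- **Plücker relation for Cayley and polarization operators.** On the polynomial ring
`ℂ[x, y, x_α, y_α, x_β, y_β, x_γ, y_γ]` (here `PRing 4`, with the main pair `(x,y)`
indexed by `0` and the symbols `α, β, γ` indexed by `1, 2, 3`), as `ℂ`-linear
endomorphisms one has `Ω_{αβ}·σ_γ = Ω_{αγ}·σ_β + Ω_{γβ}·σ_α`. -/
theorem pluecker_omega_sigma (F : PRing 4) :
    Omega 1 2 (Sigma' 3 F) = Omega 1 3 (Sigma' 2 F) + Omega 3 2 (Sigma' 1 F) := by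
  have h (a b c : Fin 4) (ha : 0 ≠ a) (hb : 0 ≠ b) : Omega a b (Sigma' c F) =
      X (0, 0) * Omega a b (pd (c, 0) F) + X (0, 1) * Omega a b (pd (c, 1) F) := by
    simp only [Sigma', LinearMap.add_apply, Module.End.mul_apply, LinearMap.mulLeft_apply,
      map_add, Omega_X_mul_of_ne ha hb]
  rw [h 1 2 3 (by decide) (by decide), h 1 3 2 (by decide) (by decide),
    h 3 2 1 (by decide) (by decide), Omega_pd_pluecker 1 2 3 0, Omega_pd_pluecker 1 2 3 1]
  ring
end
end

section
/- Binomial expansion of Cayley–polarization monomials: for every integer r ≥ 0, as ℂ-linear endomorphisms of the polynomial ring ℂ[x, y, x_α, y_α, x_β, y_β, x_γ, y_γ], one has Ω_{αβ}^r · σ_γ^r = Σ_{i=0}^{r} C(r,i) · Ω_{αγ}^{i} · Ω_{γβ}^{r−i} · σ_β^{i} · σ_α^{r−i}. -/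
noncomputable section

open MvPolynomial

/-- Partial derivatives commute. -/
theorem pd_mul_comm {k : ℕ} (v w : Fin k × Fin 2) : pd v * pd w = pd w * pd v := by
  let D (u : Fin k × Fin 2) : Derivation ℂ (PRing k) (PRing k) := pderiv u
  have h : ⁅D v, D w⁆ = 0 := by
    refine MvPolynomial.derivation_ext fun u => ?_
    classical
    simp only [D, Derivation.commutator_apply, pderiv_X, Pi.single_apply, Derivation.zero_apply]
    split_ifs <;> simp
  refine LinearMap.ext fun f => sub_eq_zero.mp ?_
  simpa [pd, D, Derivation.commutator_apply] using DFunLike.congr_fun h f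

/-- A partial derivative commutes with multiplication by a different variable. -/
theorem pd_mul_mulLeft_X {k : ℕ} {v w : Fin k × Fin 2} (h : w ≠ v) :
    pd v * LinearMap.mulLeft ℂ (X w : PRing k) = LinearMap.mulLeft ℂ (X w : PRing k) * pd v := by
  refine LinearMap.ext fun f => ?_
  simp [pd, Derivation.leibniz, pderiv_X_of_ne h]

/-- The generators of the `Ω_{ab}` and `σ_a` with `a, b ≠ 0`: the partial derivatives off the main
pair, and multiplication by the main variables. -/
def cayleyGenerators (k : ℕ) [NeZero k] : Set (Module.End ℂ (PRing k)) :=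
  {T | ∃ v : Fin k × Fin 2, v.1 ≠ 0 ∧ T = pd v} ∪
    {T | ∃ j : Fin 2, T = LinearMap.mulLeft ℂ (X ((0 : Fin k), j) : PRing k)}

/-- The commutative algebra of operators generated by `cayleyGenerators k`. -/
abbrev cayleyAlgebra (k : ℕ) [NeZero k] : Subalgebra ℂ (Module.End ℂ (PRing k)) :=
  Algebra.adjoin ℂ (cayleyGenerators k)

theorem cayleyGenerators_mul_comm {k : ℕ} [NeZero k] :
    ∀ S ∈ cayleyGenerators k, ∀ T ∈ cayleyGenerators k, S * T = T * S := by
  have ne {v : Fin k × Fin 2} (hv : v.1 ≠ 0) (j : Fin 2) : ((0 : Fin k), j) ≠ v :=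
    fun h => hv (by rw [← h])
  rintro _ (⟨v, hv, rfl⟩ | ⟨i, rfl⟩) _ (⟨w, hw, rfl⟩ | ⟨j, rfl⟩)
  · exact pd_mul_comm v w
  · exact pd_mul_mulLeft_X (ne hv j)
  · exact (pd_mul_mulLeft_X (ne hw i)).symm
  · exact LinearMap.ext fun f => by simp [mul_left_comm]

instance (k : ℕ) [NeZero k] : CommRing (cayleyAlgebra k) where
  __ := (cayleyAlgebra k).toRing
  mul_comm := (Algebra.isMulCommutative_adjoin ℂ cayleyGenerators_mul_comm).is_comm.comm

/-- The binomial expansion of powers of `[ab] (x, c) = [ac] (x, b) + [cb] (x, a)`. -/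
theorem bracket_pow_mul_pow {A : Type*} [CommRing A] (x a b c : Fin 2 → A) (r : ℕ) :
    (a 0 * b 1 - a 1 * b 0) ^ r * (x 0 * c 0 + x 1 * c 1) ^ r =
      ∑ i ∈ Finset.range (r + 1), r.choose i • ((a 0 * c 1 - a 1 * c 0) ^ i *
        (c 0 * b 1 - c 1 * b 0) ^ (r - i) * (x 0 * b 0 + x 1 * b 1) ^ i *
        (x 0 * a 0 + x 1 * a 1) ^ (r - i)) := by
  have h : (a 0 * b 1 - a 1 * b 0) * (x 0 * c 0 + x 1 * c 1) =
      (a 0 * c 1 - a 1 * c 0) * (x 0 * b 0 + x 1 * b 1) +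
        (c 0 * b 1 - c 1 * b 0) * (x 0 * a 0 + x 1 * a 1) := by ring
  rw [← mul_pow, h, add_pow]
  refine Finset.sum_congr rfl fun i _ => ?_
  rw [nsmul_eq_mul, mul_pow, mul_pow]
  ring

/-- **Binomial expansion of Cayley–polarization monomials.** On
`ℂ[x, y, x_α, y_α, x_β, y_β, x_γ, y_γ]` (here `PRing 4`, main pair indexed by `0`,
symbols `α, β, γ` indexed by `1, 2, 3`), for every `r ≥ 0` one has, as `ℂ`-linear
endomorphisms, `Ω_{αβ}^r · σ_γ^r = Σ_{i=0}^{r} C(r,i) · Ω_{αγ}^{i} · Ω_{γβ}^{r−i} ·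
σ_β^{i} · σ_α^{r−i}`. -/
theorem omega_sigma_binomial (r : ℕ) :
    (Omega 1 2 : Module.End ℂ (PRing 4)) ^ r * Sigma' 3 ^ r =
      ∑ i ∈ Finset.range (r + 1),
        r.choose i • (Omega 1 3 ^ i * Omega 3 2 ^ (r - i) * Sigma' 2 ^ i * Sigma' 1 ^ (r - i)) := by
  let D (a : Fin 4) (ha : a ≠ 0) (j : Fin 2) : cayleyAlgebra 4 :=
    ⟨pd (a, j), Algebra.subset_adjoin (Or.inl ⟨(a, j), ha, rfl⟩)⟩
  let x (j : Fin 2) : cayleyAlgebra 4 :=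
    ⟨LinearMap.mulLeft ℂ (X (0, j)), Algebra.subset_adjoin (Or.inr ⟨j, rfl⟩)⟩
  have h := congrArg (cayleyAlgebra 4).val
    (bracket_pow_mul_pow x (D 1 (by decide)) (D 2 (by decide)) (D 3 (by decide)) r)
  simp only [map_mul, map_pow, map_sum, map_nsmul, map_add, map_sub] at h
  exact h
end
end

section
/- Transvectant of powers of linear forms: let a₀, a₁, b₀, b₁ ∈ ℂ and set a_x := a₀x + a₁y, b_x := b₀x + b₁y and (ab) := a₀b₁ − a₁b₀. For all integers n, p ≥ 0 and 0 ≤ r ≤ min(n,p), the transvectant satisfies ⟨a_x^n, b_x^p⟩_r = n!·p!·(ab)^r·a_x^{n−r}·b_x^{p−r}. -/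
noncomputable section

open MvPolynomial

/-- The linear binary form `a_x := a₀·x + a₁·y`. -/
def linForm (a₀ a₁ : ℂ) : MvPolynomial (Fin 2) ℂ :=
  MvPolynomial.C a₀ * X 0 + MvPolynomial.C a₁ * X 1

/-- The linear form `c₀·x_i + c₁·y_i` in the `i`-th pair of variables. -/
def pairForm (i : Fin 3) (c : Fin 2 → ℂ) : PRing 3 :=
  MvPolynomial.C (c 0) * X (i, 0) + MvPolynomial.C (c 1) * X (i, 1)

lemma pderiv_pairForm_self (i : Fin 3) (j : Fin 2) (c : Fin 2 → ℂ) :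
    pderiv (i, j) (pairForm i c) = MvPolynomial.C (c j) := by
  fin_cases j <;> simp [pairForm, pderiv_X]

lemma pderiv_pairForm_of_ne {i k : Fin 3} (h : k ≠ i) (j : Fin 2) (c : Fin 2 → ℂ) :
    pderiv (i, j) (pairForm k c) = 0 := by
  simp [pairForm, pderiv_X, h]

/-- Differentiating a power of a linear form times a factor not involving its variables. -/
lemma pderiv_mul_pairForm_pow (i : Fin 3) (j : Fin 2) (c : Fin 2 → ℂ) (m : ℕ) {U : PRing 3}
    (hU : pderiv (i, j) U = 0) :
    pderiv (i, j) (U * pairForm i c ^ (m + 1)) =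
      ((m + 1) * c j : ℂ) • (U * pairForm i c ^ m) := by
  rw [Derivation.leibniz, Derivation.leibniz_pow, hU, pderiv_pairForm_self]
  simp [MvPolynomial.smul_eq_C_mul]
  ring

lemma Sigma'_mul_pairForm_pow (i : Fin 3) (c : Fin 2 → ℂ) (m : ℕ) {U : PRing 3}
    (hU : ∀ j, pderiv (i, j) U = 0) :
    Sigma' i (U * pairForm i c ^ (m + 1)) =
      (m + 1 : ℂ) • (U * pairForm 0 c * pairForm i c ^ m) := by
  have key (j : Fin 2) := pderiv_mul_pairForm_pow i j c m (hU j)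
  simp only [Sigma', pd, LinearMap.add_apply, Module.End.mul_apply, Derivation.coeFn_coe,
    LinearMap.mulLeft_apply, key]
  simp only [MvPolynomial.smul_eq_C_mul, pairForm, map_mul]
  ring

lemma Sigma'_pow_mul_pairForm_pow {i : Fin 3} (hi : i ≠ 0) (c : Fin 2 → ℂ) (m k : ℕ)
    {U : PRing 3} (hU : ∀ j, pderiv (i, j) U = 0) :
    (Sigma' i ^ k) (U * pairForm i c ^ (m + k)) =
      ((m + k).descFactorial k : ℂ) • (U * pairForm 0 c ^ k * pairForm i c ^ m) := by
  induction k generalizing U with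
  | zero => simp
  | succ k ih =>
    have hU' (j : Fin 2) : pderiv (i, j) (U * pairForm 0 c) = 0 := by
      simp [hU j, pderiv_pairForm_of_ne hi.symm]
    rw [pow_succ, Module.End.mul_apply, ← add_assoc, Sigma'_mul_pairForm_pow i c _ hU, map_smul,
      ih hU', smul_smul, Nat.succ_descFactorial_succ, pow_succ' (pairForm 0 c), ← mul_assoc U]
    push_cast
    rfl

lemma Omega_mul_pairForm_pow (a b : Fin 2 → ℂ) (m : ℕ) {U : PRing 3}
    (h₁ : ∀ j, pderiv (1, j) U = 0) (h₂ : ∀ j, pderiv (2, j) U = 0) :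
    Omega 1 2 (U * pairForm 1 a ^ (m + 1) * pairForm 2 b ^ (m + 1)) =
      ((m + 1) ^ 2 * (a 0 * b 1 - a 1 * b 0) : ℂ) •
        (U * pairForm 1 a ^ m * pairForm 2 b ^ m) := by
  have key₂ (j : Fin 2) := pderiv_mul_pairForm_pow 2 j b m
    (U := U * pairForm 1 a ^ (m + 1)) (by
      simp [h₂ j, Derivation.leibniz_pow, pderiv_pairForm_of_ne])
  have key₁ (j : Fin 2) : pderiv (1, j) (U * pairForm 1 a ^ (m + 1) * pairForm 2 b ^ m) =
      ((m + 1) * a j : ℂ) • (U * pairForm 1 a ^ m * pairForm 2 b ^ m) := by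
    have hU : pderiv (1, j) (U * pairForm 2 b ^ m) = 0 := by
      simp [h₁ j, Derivation.leibniz_pow, pderiv_pairForm_of_ne]
    rw [mul_right_comm U, pderiv_mul_pairForm_pow 1 j a m hU, mul_right_comm U]
  simp only [Omega, pd, LinearMap.sub_apply, Module.End.mul_apply, Derivation.coeFn_coe, key₂,
    Derivation.map_smul, key₁]
  rw [smul_smul, smul_smul, ← sub_smul]
  congr 1
  ring

lemma Omega_pow_mul_pairForm_pow (a b : Fin 2 → ℂ) (m : ℕ) {U : PRing 3}
    (h₁ : ∀ j, pderiv (1, j) U = 0) (h₂ : ∀ j, pderiv (2, j) U = 0) :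
    (Omega 1 2 ^ m) (U * pairForm 1 a ^ m * pairForm 2 b ^ m) =
      ((m.factorial : ℂ) ^ 2 * (a 0 * b 1 - a 1 * b 0) ^ m) • U := by
  induction m with
  | zero => simp
  | succ m ih =>
    rw [pow_succ (Omega 1 2), Module.End.mul_apply, Omega_mul_pairForm_pow a b m h₁ h₂, map_smul,
      ih, smul_smul, Nat.factorial_succ]
    congr 1
    push_cast
    ring

lemma embP_linForm (i : Fin 3) (c : Fin 2 → ℂ) : embP i (linForm (c 0) (c 1)) = pairForm i c := by
  simp [embP, linForm, pairForm]

lemma toMain_pairForm (i : Fin 3) (c : Fin 2 → ℂ) :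
    toMain (pairForm i c) = linForm (c 0) (c 1) := by
  simp [toMain, linForm, pairForm, MvPolynomial.algebraMap_eq]

/-- Iterated polarization and Cayley operators applied to a product of powers of linear forms. -/
lemma Omega_pow_Sigma'_pow_pairForm_pow (a b : Fin 2 → ℂ) (r k l : ℕ) :
    (Omega 1 2 ^ r) ((Sigma' 1 ^ k) ((Sigma' 2 ^ l)
      (pairForm 1 a ^ (r + k) * pairForm 2 b ^ (r + l)))) =
      (((r + k).factorial : ℂ) * (r + l).factorial * (a 0 * b 1 - a 1 * b 0) ^ r) •
        (pairForm 0 a ^ k * pairForm 0 b ^ l) := by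
  have hfac (s : ℕ) : ((r + s).factorial : ℂ) = r.factorial * (r + s).descFactorial s := by
    have h := Nat.factorial_mul_descFactorial (Nat.le_add_left s r)
    rw [Nat.add_sub_cancel] at h
    exact_mod_cast h.symm
  rw [Sigma'_pow_mul_pairForm_pow (by decide) b r l
      (by simp [Derivation.leibniz_pow, pderiv_pairForm_of_ne]), map_smul,
    show pairForm 1 a ^ (r + k) * pairForm 0 b ^ l * pairForm 2 b ^ r =
      pairForm 0 b ^ l * pairForm 2 b ^ r * pairForm 1 a ^ (r + k) by ring,
    Sigma'_pow_mul_pairForm_pow (by decide) a r k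
      (by simp [Derivation.leibniz_pow, pderiv_pairForm_of_ne]), map_smul, map_smul,
    show pairForm 0 b ^ l * pairForm 2 b ^ r * pairForm 0 a ^ k * pairForm 1 a ^ r =
      pairForm 0 a ^ k * pairForm 0 b ^ l * pairForm 1 a ^ r * pairForm 2 b ^ r by ring,
    Omega_pow_mul_pairForm_pow a b r
      (by simp [Derivation.leibniz_pow, pderiv_pairForm_of_ne])
      (by simp [Derivation.leibniz_pow, pderiv_pairForm_of_ne]),
    smul_smul, smul_smul, hfac k, hfac l]
  congr 1
  ring

/-- **Transvectant of powers of linear forms.** With `a_x := a₀x + a₁y`,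
`b_x := b₀x + b₁y` and `(ab) := a₀b₁ − a₁b₀`, for all `n, p ≥ 0` and
`0 ≤ r ≤ min n p` one has `⟨a_x^n, b_x^p⟩_r = n!·p!·(ab)^r·a_x^{n−r}·b_x^{p−r}`. -/
theorem transvectant_powers_of_linear_forms (a₀ a₁ b₀ b₁ : ℂ) (n p r : ℕ)
    (hr : r ≤ min n p) :
    transv n p r (linForm a₀ a₁ ^ n) (linForm b₀ b₁ ^ p) =
      MvPolynomial.C ((n.factorial : ℂ) * (p.factorial : ℂ) * (a₀ * b₁ - a₁ * b₀) ^ r) *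
        linForm a₀ a₁ ^ (n - r) * linForm b₀ b₁ ^ (p - r) := by
  obtain ⟨k, rfl⟩ := Nat.exists_eq_add_of_le (hr.trans (min_le_left n p))
  obtain ⟨l, rfl⟩ := Nat.exists_eq_add_of_le (hr.trans (min_le_right _ p))
  have ha (i : Fin 3) : embP i (linForm a₀ a₁) = pairForm i ![a₀, a₁] :=
    embP_linForm i ![a₀, a₁]
  have hb (i : Fin 3) : embP i (linForm b₀ b₁) = pairForm i ![b₀, b₁] :=
    embP_linForm i ![b₀, b₁]
  rw [transv, if_pos hr, map_pow, map_pow, ha, hb, Nat.add_sub_cancel_left,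
    Nat.add_sub_cancel_left, Omega_pow_Sigma'_pow_pairForm_pow, map_smul, map_mul, map_pow,
    map_pow, toMain_pairForm, toMain_pairForm, MvPolynomial.smul_eq_C_mul, ← mul_assoc (MvPolynomial.C _)]
  rfl
end
end

section
/- Monomial reduction with one- and two-variable relations: let A be a commutative ℂ-algebra generated by elements x₁, …, x_p. Suppose that for each i in a set I ⊆ {1, …, p−1} there is an integer a_i ≥ 1 with x_i^{a_i} = Σ_{k=0}^{a_i−1} x_i^{k} · p_k^{(i)}(x_{i+1}, …, x_p), and that for each j in a finite index set J there are indices b(j) < c(j), integers B_j, C_j ≥ 1, and a polynomial q^{(j)} such that x_{b(j)}^{B_j} · x_{c(j)}^{C_j} = q^{(j)}(x_{c(j)+1}, …, x_p). Then A is spanned as a ℂ-vector space by the monomials x₁^{r₁}⋯x_p^{r_p} divisible by no x_i^{a_i} (i ∈ I) and by no x_{b(j)}^{B_j} x_{c(j)}^{C_j} (j ∈ J). -/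
/-- The algebra generated by the `x i` with `i ∈ s` is contained in the span of the monomials
whose exponents vanish outside `s`. -/
theorem adjoin_image_le_span_prod_pow {R A ι : Type*} [CommSemiring R] [CommSemiring A]
    [Algebra R A] [Fintype ι] (x : ι → A) (s : Set ι) :
    Subalgebra.toSubmodule (Algebra.adjoin R (x '' s)) ≤
      Submodule.span R {w : A | ∃ e : ι → ℕ, (∀ k ∉ s, e k = 0) ∧ w = ∏ k, x k ^ e k} := by
  classical
  rw [Algebra.adjoin_eq_span]
  refine Submodule.span_mono fun w hw => ?_
  induction hw using Submonoid.closure_induction with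
  | mem y hy =>
    obtain ⟨i, hi, rfl⟩ := hy
    refine ⟨Pi.single i 1, fun k hk => Pi.single_eq_of_ne (by rintro rfl; exact hk hi) _, ?_⟩
    rw [Finset.prod_eq_single i (fun k _ hk => by simp [hk]) (by simp)]
    simp
  | one => exact ⟨0, by simp, by simp⟩
  | mul y z _ _ hy hz =>
    obtain ⟨e, he, rfl⟩ := hy
    obtain ⟨f, hf, rfl⟩ := hz
    exact ⟨e + f, fun k hk => by simp [he k hk, hf k hk],
      by simp [pow_add, Finset.prod_mul_distrib]⟩

/-- If `t` agrees with `r` before `i` and is smaller at `i`, then multiplying the monomial with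
exponents `t` by a polynomial in the generators after `i` stays in every submodule containing
all monomials lexicographically below `r`. -/
theorem prod_pow_mul_mem_of_lex_lt {R A ι : Type*} [CommSemiring R] [CommSemiring A]
    [Algebra R A] [Fintype ι] [LinearOrder ι] {x : ι → A} {S : Submodule R A} {r : ι → ℕ}
    (hS : ∀ r' : ι → ℕ, toLex r' < toLex r → ∏ k, x k ^ r' k ∈ S)
    {i : ι} {t : ι → ℕ} (ht : ∀ k < i, t k = r k) (hti : t i < r i)
    {q : A} (hq : q ∈ Algebra.adjoin R (x '' {k | i < k})) :
    (∏ k, x k ^ t k) * q ∈ S := by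
  have hle : Submodule.span R
      {w : A | ∃ e : ι → ℕ, (∀ k ∉ {k | i < k}, e k = 0) ∧ w = ∏ k, x k ^ e k} ≤
      S.comap (LinearMap.mulLeft R (∏ k, x k ^ t k)) := by
    rw [Submodule.span_le]
    rintro _ ⟨e, he, rfl⟩
    have hlt : toLex (t + e) < toLex r :=
      ⟨i, fun k hk => by simp [ht k hk, he k (by simpa using hk.le)],
        by simpa [he i (by simp)] using hti⟩
    simpa [pow_add, Finset.prod_mul_distrib] using hS _ hlt
  exact hle (adjoin_image_le_span_prod_pow x _ hq)

/-- Splitting off the factor with exponents `d` from a monomial divisible by it. -/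
theorem prod_pow_sub_mul_prod_pow {A ι : Type*} [CommMonoid A] [Fintype ι] (x : ι → A)
    {r d : ι → ℕ} (h : d ≤ r) :
    (∏ k, x k ^ (r - d) k) * ∏ k, x k ^ d k = ∏ k, x k ^ r k := by
  rw [← Finset.prod_mul_distrib]
  refine Finset.prod_congr rfl fun k _ => ?_
  rw [← pow_add, Pi.sub_apply, Nat.sub_add_cancel (h k)]

theorem prod_pow_pi_single {A ι : Type*} [CommMonoid A] [Fintype ι] [DecidableEq ι] (x : ι → A)
    (i : ι) (n : ℕ) : ∏ k, x k ^ (Pi.single i n : ι → ℕ) k = x i ^ n := by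
  rw [Finset.prod_eq_single i (fun k _ hk => by simp [hk]) (by simp)]
  simp


/-- **Monomial reduction with one- and two-variable relations.** Let `A` be a
commutative `ℂ`-algebra generated by `x 0, …, x (p-1)`. Suppose that for each `i`
in a set `I` of indices among `{0, …, p−2}` there is an integer `a i ≥ 1` with
`x i ^ a i = Σ_{k < a i} x i ^ k * c k`, each `c k` a polynomial in the later
generators, and that for each `j` in a finite index set `J` there are indices
`b j < c j`, integers `B j, C j ≥ 1`, and an element `q` polynomial in the
generators of index `> c j` such that `x (b j) ^ B j * x (c j) ^ C j = q`. Then `A`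
is spanned as a `ℂ`-vector space by the monomials `∏ k, x k ^ r k` divisible by no
`x i ^ a i` (`i ∈ I`) and by no `x (b j) ^ B j * x (c j) ^ C j` (`j ∈ J`). -/
theorem monomial_reduction_weighted_relations
    (A : Type*) [CommRing A] [Algebra ℂ A] (p : ℕ) (x : Fin p → A)
    (hgen : Algebra.adjoin ℂ (Set.range x) = ⊤)
    (I : Set (Fin p)) (hI : ∀ i ∈ I, (i : ℕ) + 1 < p)
    (a : Fin p → ℕ) (ha : ∀ i ∈ I, 1 ≤ a i)
    (hrel : ∀ i ∈ I, ∃ c : ℕ → A,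
      (∀ k, c k ∈ Algebra.adjoin ℂ (x '' {j | i < j})) ∧
      x i ^ a i = ∑ k ∈ Finset.range (a i), x i ^ k * c k)
    (J : Type*) [Finite J] (b c : J → Fin p) (hbc : ∀ j, b j < c j)
    (B C : J → ℕ) (hB : ∀ j, 1 ≤ B j) (hC : ∀ j, 1 ≤ C j)
    (hrel2 : ∀ j, ∃ q : A, q ∈ Algebra.adjoin ℂ (x '' {k | c j < k}) ∧
      x (b j) ^ B j * x (c j) ^ C j = q) :
    Submodule.span ℂ
      {w : A | ∃ r : Fin p → ℕ, w = ∏ k, x k ^ r k ∧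
        (∀ i ∈ I, r i < a i) ∧
        ∀ j : J, ¬(B j ≤ r (b j) ∧ C j ≤ r (c j))} = ⊤ := by
  set S := Submodule.span ℂ
      {w : A | ∃ r : Fin p → ℕ, w = ∏ k, x k ^ r k ∧
        (∀ i ∈ I, r i < a i) ∧
        ∀ j : J, ¬(B j ≤ r (b j) ∧ C j ≤ r (c j))}
  have key : ∀ r : Lex (Fin p → ℕ), ∏ k, x k ^ ofLex r k ∈ S := by
    intro r
    induction r using WellFoundedLT.induction with
    | ind r ih =>
    have hS : ∀ r' : Fin p → ℕ, toLex r' < toLex (ofLex r) → ∏ k, x k ^ r' k ∈ S :=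
      fun r' h => ih (toLex r') h
    generalize ofLex r = r at hS ⊢
    by_cases h1 : ∀ i ∈ I, r i < a i
    · by_cases h2 : ∀ j : J, ¬(B j ≤ r (b j) ∧ C j ≤ r (c j))
      · exact Submodule.subset_span ⟨r, rfl, h1, h2⟩
      push Not at h2
      obtain ⟨j, hBj, hCj⟩ := h2
      obtain ⟨q, hq, hrq⟩ := hrel2 j
      have hne := hbc j
      have hd : Pi.single (b j) (B j) + Pi.single (c j) (C j) ≤ r := by
        intro k
        rcases eq_or_ne k (b j) with rfl | hkb
        · simpa [hne.ne] using hBj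
        rcases eq_or_ne k (c j) with rfl | hkc
        · simpa [hne.ne'] using hCj
        · simp [hkb, hkc]
      have hprod :
          ∏ k, x k ^ (Pi.single (b j) (B j) + Pi.single (c j) (C j) : Fin p → ℕ) k = q := by
        simp_rw [Pi.add_apply, pow_add, Finset.prod_mul_distrib, prod_pow_pi_single, hrq]
      rw [← prod_pow_sub_mul_prod_pow x hd, hprod]
      refine prod_pow_mul_mem_of_lex_lt hS (i := b j) (fun k hk => ?_) ?_
        (Algebra.adjoin_mono (Set.image_mono fun k hk => hne.trans hk) hq)
      · simp [hk.ne, (hk.trans hne).ne]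
      · have := hB j
        simp [hne.ne]
        omega
    · push Not at h1
      obtain ⟨i, hi, hai⟩ := h1
      obtain ⟨f, hf, hxi⟩ := hrel i hi
      have hd : Pi.single i (a i) ≤ r := by
        intro k
        rcases eq_or_ne k i with rfl | hk
        · simpa using hai
        · simp [hk]
      rw [← prod_pow_sub_mul_prod_pow x hd, prod_pow_pi_single, hxi, Finset.mul_sum]
      refine Submodule.sum_mem _ fun n hn => ?_
      rw [Finset.mem_range] at hn
      have hmon : (∏ k, x k ^ (r - Pi.single i (a i) : Fin p → ℕ) k) * x i ^ n =
          ∏ k, x k ^ (r - Pi.single i (a i) + Pi.single i n : Fin p → ℕ) k := by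
        simp_rw [Pi.add_apply, pow_add, Finset.prod_mul_distrib, prod_pow_pi_single]
      rw [← mul_assoc, hmon]
      refine prod_pow_mul_mem_of_lex_lt hS (i := i) (fun k hk => ?_) ?_ (hf n)
      · simp [hk.ne]
      · simp only [Pi.add_apply, Pi.sub_apply, Pi.single_eq_same]
        omega
  rw [eq_top_iff, ← Algebra.top_toSubmodule, ← hgen, ← Set.image_univ]
  refine (adjoin_image_le_span_prod_pow x Set.univ).trans (Submodule.span_le.mpr ?_)
  rintro _ ⟨e, -, rfl⟩
  exact key (toLex e)
end

section
/- Generation of joint covariants by transvectants of monomials: let V₁, V₂ be spaces of binary forms and let A = {f₁, …, f_p} ⊂ Cov(V₁) and B = {g₁, …, g_q} ⊂ Cov(V₂) be finite generating sets of homogeneous covariants. Then Cov(V₁ ⊕ V₂) is generated as a ℂ-algebra by the transvectants ⟨U, W⟩_r, where r ranges over the nonnegative integers, U := f₁^{α₁}⋯f_p^{α_p} ranges over the monomials in A, and W := g₁^{β₁}⋯g_q^{β_q} ranges over the monomials in B. -/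
noncomputable section

open MvPolynomial

/-- Coordinates on `V ⊕ ℂ²`, where `V = ⊕ i, S_{ν i}` is a space of binary forms:
for each summand `S_{ν i}` there are `ν i + 1` coefficient coordinates, and there are
two extra coordinates for the variables `(x, y)` of `ℂ²`. -/
abbrev Var {ι : Type} (ν : ι → ℕ) : Type := (Σ i : ι, Fin (ν i + 1)) ⊕ Fin 2

/-- The coordinate ring `ℂ[V ⊕ ℂ²]`. -/
abbrev CoordRing {ι : Type} (ν : ι → ℕ) : Type := MvPolynomial (Var ν) ℂ

/-- The binary form of degree `n` with coefficient vector `a`. -/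
def form (n : ℕ) (a : Fin (n + 1) → ℂ) : MvPolynomial (Fin 2) ℂ :=
  ∑ i : Fin (n + 1), MvPolynomial.C (a i) * X 0 ^ (n - (i : ℕ)) * X 1 ^ (i : ℕ)

/-- Substitution `x ↦ g⁻¹ · x` on `ℂ[x,y]`; this sends a degree-`n` binary form `f`
to the form `g · f = f ∘ g⁻¹`. -/
def subst2 (g : SL2) : MvPolynomial (Fin 2) ℂ →ₐ[ℂ] MvPolynomial (Fin 2) ℂ :=
  aeval fun i => ∑ j : Fin 2, MvPolynomial.C ((g⁻¹).1 i j) * X j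

/-- The coefficient vector of a degree-`n` binary form. -/
def coeffOf (n : ℕ) (p : MvPolynomial (Fin 2) ℂ) (i : Fin (n + 1)) : ℂ :=
  MvPolynomial.coeff (Finsupp.single 0 (n - (i : ℕ)) + Finsupp.single 1 ((i : ℕ))) p

/-- The action of `g ∈ SL(2,ℂ)` on the coefficient vector of a degree-`n` binary form,
corresponding to `g · f := f ∘ g⁻¹`. -/
def coeffAct (g : SL2) (n : ℕ) (a : Fin (n + 1) → ℂ) : Fin (n + 1) → ℂ :=
  coeffOf n (subst2 g (form n a))

/-- The action of `g ∈ SL(2,ℂ)` on points of `V ⊕ ℂ²`: `( f, x ) ↦ ( g·f, g·x )`. -/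
def ptAct {ι : Type} (ν : ι → ℕ) (g : SL2) (pt : Var ν → ℂ) : Var ν → ℂ :=
  Sum.elim
    (fun c => coeffAct g (ν c.1) (fun k => pt (Sum.inl ⟨c.1, k⟩)) c.2)
    (fun i => ∑ j : Fin 2, (g).1 i j * pt (Sum.inr j))

/-- The covariant algebra `Cov(V) := ℂ[V ⊕ ℂ²]^{SL(2,ℂ)}`: the polynomial functions `p`
on `V ⊕ ℂ²` with `p(g·f, g·x) = p(f, x)` for all `g`, i.e. `(g·p) = p` for all `g`. -/
def Covariants {ι : Type} (ν : ι → ℕ) : Subalgebra ℂ (CoordRing ν) where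
  carrier := {p | ∀ (g : SL2) (pt : Var ν → ℂ), eval (ptAct ν g pt) p = eval pt p}
  mul_mem' := by
    intro a b ha hb g pt
    simp only [map_mul, ha g pt, hb g pt]
  one_mem' := by intro g pt; simp
  add_mem' := by
    intro a b ha hb g pt
    simp only [map_add, ha g pt, hb g pt]
  zero_mem' := by intro g pt; simp
  algebraMap_mem' := by intro c g pt; simp [MvPolynomial.algebraMap_eq]

/-- The weight giving the natural bigraduation of `ℂ[V ⊕ ℂ²]` by
(degree in the coefficients of `V`, order in `x`). -/
def wBi {ι : Type} (ν : ι → ℕ) : Var ν → ℕ × ℕ :=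
  Sum.elim (fun _ => (1, 0)) (fun _ => (0, 1))

/-- `V ⊕ ℂ²` coordinates together with three pairs of variables
`(x,y), (x_α,y_α), (x_β,y_β)` (indexed by `0`, `1`, `2`). -/
abbrev TVar {ι : Type} (ν : ι → ℕ) : Type := (Σ i : ι, Fin (ν i + 1)) ⊕ (Fin 3 × Fin 2)

abbrev TRing {ι : Type} (ν : ι → ℕ) : Type := MvPolynomial (TVar ν) ℂ

/-- Embed `ℂ[V ⊕ ℂ²]` into `TRing ν`, sending `(x,y)` to the pair indexed by `a`
and keeping the coefficients of `V` as constants. -/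
def embT {ι : Type} (ν : ι → ℕ) (a : Fin 3) : CoordRing ν →ₐ[ℂ] TRing ν :=
  rename (Sum.map id fun i => (a, i))

/-- Partial derivative on `TRing ν` as `ℂ`-linear endomorphism. -/
def pdT {ι : Type} (ν : ι → ℕ) (v : Fin 3 × Fin 2) : Module.End ℂ (TRing ν) :=
  (pderiv (Sum.inr v)).toLinearMap

/-- The Cayley operator `Ω_{ab}`. -/
def OmegaT {ι : Type} (ν : ι → ℕ) (a b : Fin 3) : Module.End ℂ (TRing ν) :=
  pdT ν (a, 0) * pdT ν (b, 1) - pdT ν (a, 1) * pdT ν (b, 0)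

/-- The polarization operator `σ_a := x·∂/∂x_a + y·∂/∂y_a`. -/
def SigmaT {ι : Type} (ν : ι → ℕ) (a : Fin 3) : Module.End ℂ (TRing ν) :=
  (LinearMap.mulLeft ℂ (X (Sum.inr (0, 0)) : TRing ν) : Module.End ℂ (TRing ν)) * pdT ν (a, 0)
    + (LinearMap.mulLeft ℂ (X (Sum.inr (0, 1)) : TRing ν) : Module.End ℂ (TRing ν)) * pdT ν (a, 1)

/-- The map `TRing ν → ℂ[V ⊕ ℂ²]` restricting to the diagonal `x_α = x_β = x`. -/
def collapseT {ι : Type} (ν : ι → ℕ) : TRing ν →ₐ[ℂ] CoordRing ν :=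
  aeval (Sum.elim (fun c => (X (Sum.inl c) : CoordRing ν)) (fun v => X (Sum.inr v.2)))

/-- The transvectant `⟨U, W⟩_r` of two covariants `U, W` of orders `u₀`, `w₀`:
`⟨U,W⟩_r := Ω_{αβ}^r σ_α^{u₀−r} σ_β^{w₀−r} ( U(x_α,y_α)·W(x_β,y_β) )` when
`0 ≤ r ≤ min u₀ w₀` (the coefficients of `V` being carried along as constants),
and `⟨U,W⟩_r := 0` for `r > min u₀ w₀`. -/
def transvect {ι : Type} (ν : ι → ℕ) (u₀ w₀ r : ℕ) (U W : CoordRing ν) : CoordRing ν :=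
  if r ≤ min u₀ w₀ then
    collapseT ν ((OmegaT ν 1 2 ^ r)
      ((SigmaT ν 1 ^ (u₀ - r)) ((SigmaT ν 2 ^ (w₀ - r)) (embT ν 1 U * embT ν 2 W))))
  else 0

/-- The natural embedding `ℂ[V₁ ⊕ ℂ²] → ℂ[(V₁ ⊕ V₂) ⊕ ℂ²]`, realizing `Cov(V₁)`
as a subalgebra of `Cov(V₁ ⊕ V₂)`. -/
def embL {ι₁ ι₂ : Type} (n : ι₁ → ℕ) (m : ι₂ → ℕ) :
    CoordRing n →ₐ[ℂ] CoordRing (Sum.elim n m) :=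
  rename (Sum.map
    (fun c => (⟨Sum.inl c.1, c.2⟩ : Σ k : ι₁ ⊕ ι₂, Fin (Sum.elim n m k + 1))) id)

/-- The natural embedding `ℂ[V₂ ⊕ ℂ²] → ℂ[(V₁ ⊕ V₂) ⊕ ℂ²]`, realizing `Cov(V₂)`
as a subalgebra of `Cov(V₁ ⊕ V₂)`. -/
def embR {ι₁ ι₂ : Type} (n : ι₁ → ℕ) (m : ι₂ → ℕ) :
    CoordRing m →ₐ[ℂ] CoordRing (Sum.elim n m) :=
  rename (Sum.map
    (fun c => (⟨Sum.inr c.1, c.2⟩ : Σ k : ι₁ ⊕ ι₂, Fin (Sum.elim n m k + 1))) id)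

/-- The universal binary form of the `i`-th summand of `V`, viewed as a covariant
in `ℂ[V ⊕ ℂ²]` (for `ν i = 2`, this is "the generic binary quadratic `u`"). -/
def univForm {ι : Type} (ν : ι → ℕ) (i : ι) : CoordRing ν :=
  ∑ j : Fin (ν i + 1),
    X (Sum.inl ⟨i, j⟩) * X (Sum.inr 0) ^ (ν i - (j : ℕ)) * X (Sum.inr 1) ^ (j : ℕ)

/-! ### The Reynolds functional on `SL(2)` -/

/-- The value on the monomial `∏ G_{ij}^{s_{ij}}` of the normalised invariant functional
on polynomial functions on `SL(2,ℂ)`. -/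
def haarWeight (s : Fin 2 × Fin 2 →₀ ℕ) : ℂ :=
  if s (0, 0) = s (1, 1) ∧ s (0, 1) = s (1, 0) then
    (-1) ^ s (0, 1) * (s (0, 0)).factorial * (s (0, 1)).factorial /
      (s (0, 0) + s (0, 1) + 1).factorial
  else 0

/-- The normalised invariant functional on polynomial functions on `SL(2,ℂ)`, extended linearly
to coefficients in a `ℂ`-algebra `B`. -/
def haar (B : Type) [CommRing B] [Algebra ℂ B] :
    MvPolynomial (Fin 2 × Fin 2) B →ₗ[B] B :=
  (basisMonomials (Fin 2 × Fin 2) B).constr B fun s => algebraMap ℂ B (haarWeight s)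

section RowForms

variable {B : Type} [CommRing B]

/-- The Euler derivation of the `i`-th row of the generic matrix. -/
def rowEuler (B : Type) [CommRing B] (i : Fin 2) :
    Derivation B (MvPolynomial (Fin 2 × Fin 2) B) (MvPolynomial (Fin 2 × Fin 2) B) :=
  (X (i, 0) : MvPolynomial (Fin 2 × Fin 2) B) • pderiv (i, 0) +
    (X (i, 1) : MvPolynomial (Fin 2 × Fin 2) B) • pderiv (i, 1)

lemma rowEuler_monomial (i : Fin 2) (s : Fin 2 × Fin 2 →₀ ℕ) (c : B) :
    rowEuler B i (monomial s c) = (s (i, 0) + s (i, 1)) • monomial s c := by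
  simp only [rowEuler, Derivation.add_apply, Derivation.smul_apply, smul_eq_mul,
    X_mul_pderiv_monomial, add_smul]

/-- The linear form in the `i`-th row of the generic matrix with coefficients `c`. -/
def rowForm (i : Fin 2) (c : Fin 2 → B) : MvPolynomial (Fin 2 × Fin 2) B :=
  C (c 0) * X (i, 0) + C (c 1) * X (i, 1)

/-- The derivation along the second row dual to a linear form in the first row. -/
def rowDeriv (c : Fin 2 → B) :
    Derivation B (MvPolynomial (Fin 2 × Fin 2) B) (MvPolynomial (Fin 2 × Fin 2) B) :=
  c 0 • pderiv (1, 1) - c 1 • pderiv (1, 0)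

lemma rowEuler_rowForm (i j : Fin 2) (c : Fin 2 → B) :
    rowEuler B i (rowForm j c) = if i = j then rowForm j c else 0 := by
  fin_cases i <;> fin_cases j <;>
    simp [rowEuler, rowForm, pderiv_X, mul_comm]

lemma rowDeriv_rowForm_zero (c d : Fin 2 → B) : rowDeriv c (rowForm 0 d) = 0 := by
  simp [rowDeriv, rowForm, pderiv_X]

lemma rowDeriv_rowForm_one (c d : Fin 2 → B) :
    rowDeriv c (rowForm 1 d) = C (c 0 * d 1 - c 1 * d 0) := by
  simp [rowDeriv, rowForm, pderiv_X, smul_eq_C_mul]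

lemma rowEuler_prod_rowForm (i j : Fin 2) (l : List (Fin 2 → B)) :
    rowEuler B i (l.map (rowForm j)).prod =
      (if i = j then l.length else 0) • (l.map (rowForm j)).prod := by
  induction l with
  | nil => simp
  | cons c l ih =>
    rw [List.map_cons, List.prod_cons, Derivation.leibniz, ih, rowEuler_rowForm]
    split_ifs with h
    · simp only [smul_eq_mul, nsmul_eq_mul, List.length_cons]; push_cast; ring
    · simp

lemma rowDeriv_prod_rowForm_zero (c : Fin 2 → B) (l : List (Fin 2 → B)) :
    rowDeriv c (l.map (rowForm 0)).prod = 0 := by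
  induction l with
  | nil => simp
  | cons d l ih => simp [ih, rowDeriv_rowForm_zero]

end RowForms

section Haar

variable {B : Type} [CommRing B] [Algebra ℂ B]

lemma haar_monomial (s : Fin 2 × Fin 2 →₀ ℕ) (c : B) :
    haar B (monomial s c) = c * algebraMap ℂ B (haarWeight s) := by
  have h : monomial s c = c • basisMonomials (Fin 2 × Fin 2) B s := by
    simp [smul_monomial]
  rw [h, map_smul, haar, Module.Basis.constr_basis, smul_eq_mul]

lemma haar_one : haar B 1 = 1 := by
  have := haar_monomial (B := B) 0 1
  simpa [haarWeight] using this

lemma haarWeight_det (s : Fin 2 × Fin 2 →₀ ℕ) :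
    haarWeight (s + Finsupp.single (0, 0) 1 + Finsupp.single (1, 1) 1) -
      haarWeight (s + Finsupp.single (0, 1) 1 + Finsupp.single (1, 0) 1) = haarWeight s := by
  simp only [haarWeight, Finsupp.add_apply, Finsupp.single_apply]
  simp
  by_cases h : s (0, 0) = s (1, 1) ∧ s (0, 1) = s (1, 0)
  · simp only [if_pos h]
    rw [show s (0,0) + 1 + s (0,1) + 1 = (s (0,0) + s (0,1) + 1) + 1 by ring,
      show s (0,0) + (s (0,1) + 1) + 1 = (s (0,0) + s (0,1) + 1) + 1 by ring]
    simp only [Nat.factorial_succ (s (0,0) + s (0,1) + 1), Nat.factorial_succ (s (0,0)),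
      Nat.factorial_succ (s (0,1))]
    have h1 : ((s (0,0) + s (0,1) + 1).factorial : ℂ) ≠ 0 := by
      exact_mod_cast Nat.factorial_ne_zero _
    have h2 : ((s (0,0) : ℂ) + s (0,1) + 1 + 1) ≠ 0 := by
      exact_mod_cast Nat.succ_ne_zero (s (0,0) + s (0,1) + 1)
    push_cast
    field_simp
    ring
  · simp only [if_neg h, sub_zero]

/-- The determinant of the generic matrix minus one. -/
def detSubOne (B : Type) [CommRing B] : MvPolynomial (Fin 2 × Fin 2) B :=
  X (0, 0) * X (1, 1) - X (0, 1) * X (1, 0) - 1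

lemma haar_detSubOne_mul (F : MvPolynomial (Fin 2 × Fin 2) B) :
    haar B (detSubOne B * F) = 0 := by
  induction F using MvPolynomial.induction_on' with
  | add p q hp hq => rw [mul_add, map_add, hp, hq, add_zero]
  | monomial s c =>
    have h : detSubOne B * monomial s c =
        monomial (s + Finsupp.single (0, 0) 1 + Finsupp.single (1, 1) 1) c -
        monomial (s + Finsupp.single (0, 1) 1 + Finsupp.single (1, 0) 1) c - monomial s c := by
      simp only [detSubOne, X, sub_mul, monomial_mul, one_mul]
      congr 3 <;> abel_nf
    rw [h, map_sub, map_sub, haar_monomial, haar_monomial, haar_monomial, ← mul_sub, ← map_sub,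
      haarWeight_det, sub_self]

lemma irreducible_detSubOne : Irreducible (detSubOne ℂ) := by
  have h := irreducible_mul_X_add (X (0, 0) : MvPolynomial (Fin 2 × Fin 2) ℂ)
    (-(X (0, 1) * X (1, 0)) - 1) (1, 1) (X_ne_zero _) (by simp [vars_X])
    (by
      intro h
      have h1 := vars_sub_subset (p := -(X (0, 1) * X (1, 0) : MvPolynomial (Fin 2 × Fin 2) ℂ)) h
      rw [vars_neg, vars_one, Finset.union_empty] at h1
      have h2 := vars_mul _ _ h1
      simp [vars_X] at h2)
    (by
      have hX : Prime (X (0, 0) : MvPolynomial (Fin 2 × Fin 2) ℂ) := X_prime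
      rw [hX.irreducible.isRelPrime_iff_not_dvd]
      rintro ⟨q, hq⟩
      simpa using congrArg (eval 0) hq)
  convert h using 1
  simp only [detSubOne]; ring

lemma haar_eq_zero_of_eval_eq_zero (F : MvPolynomial (Fin 2 × Fin 2) ℂ)
    (hF : ∀ g : SL2, eval (fun v => g.1 v.1 v.2) F = 0) : haar ℂ F = 0 := by
  have hp : (Ideal.span {detSubOne ℂ}).IsPrime :=
    (Ideal.span_singleton_prime irreducible_detSubOne.ne_zero).2 irreducible_detSubOne.prime
  have hmem : F ∈ Ideal.span {detSubOne ℂ} := by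
    rw [← MvPolynomial.IsPrime.vanishingIdeal_zeroLocus (K := ℂ) (Ideal.span {detSubOne ℂ}) ]
    rw [mem_vanishingIdeal_iff]
    intro x hx
    have hx' := (mem_zeroLocus_iff.1 hx) _ (Ideal.mem_span_singleton_self _)
    have := hF ⟨Matrix.of fun i j => x (i, j), by
      simp [detSubOne] at hx'
      rw [Matrix.det_fin_two]
      simp only [Matrix.of_apply]
      linear_combination hx'⟩
    rw [aeval_eq_eval]
    simpa using this
  obtain ⟨q, rfl⟩ := Ideal.mem_span_singleton'.1 hmem
  rw [mul_comm, haar_detSubOne_mul]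

lemma haar_rowEuler (F : MvPolynomial (Fin 2 × Fin 2) B) :
    haar B (rowEuler B 0 F) = haar B (rowEuler B 1 F) := by
  induction F using MvPolynomial.induction_on' with
  | add p q hp hq => simp only [map_add, hp, hq]
  | monomial s c =>
    rw [rowEuler_monomial, rowEuler_monomial, map_nsmul, map_nsmul, haar_monomial, haarWeight]
    split_ifs with h
    · rw [h.1, h.2, add_comm]
    · simp

lemma haarWeight_add_single_zero (s : Fin 2 × Fin 2 →₀ ℕ) :
    ((s (1, 0) + s (1, 1) + 1 : ℕ) : ℂ) * haarWeight (s + Finsupp.single (0, 0) 1) =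
      (s (1, 1) * haarWeight (s - Finsupp.single (1, 1) 1)) := by
  simp only [haarWeight, Finsupp.add_apply, Finsupp.tsub_apply, Finsupp.single_apply]
  simp
  generalize s (0, 0) = a, s (0, 1) = b, s (1, 0) = c, s (1, 1) = d
  rcases d with _ | k
  · simp
  · simp only [Nat.add_sub_cancel, Nat.add_right_cancel_iff]
    split_ifs with h
    · obtain ⟨rfl, rfl⟩ := h
      simp only [Nat.factorial_succ]
      have h1 : ((a + b).factorial : ℂ) ≠ 0 := by exact_mod_cast Nat.factorial_ne_zero _
      rw [show a + 1 + b = a + b + 1 by ring]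
      simp only [Nat.factorial_succ]
      have h2 : ((a : ℂ) + b + 1) ≠ 0 := by exact_mod_cast Nat.succ_ne_zero (a + b)
      have h3 : ((a : ℂ) + b + 1 + 1) ≠ 0 := by exact_mod_cast Nat.succ_ne_zero (a + b + 1)
      push_cast
      field_simp
      ring
    · simp

lemma haar_X_zero_mul (F : MvPolynomial (Fin 2 × Fin 2) B) :
    haar B (X (0, 0) * (rowEuler B 1 F + F)) = haar B (pderiv (1, 1) F) := by
  induction F using MvPolynomial.induction_on' with
  | add p q hp hq =>
    rw [show X (0, 0) * (rowEuler B 1 (p + q) + (p + q)) =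
      X (0, 0) * (rowEuler B 1 p + p) + X (0, 0) * (rowEuler B 1 q + q) by rw [map_add]; ring,
      map_add, hp, hq, map_add, map_add]
  | monomial s c =>
    have hX : X (0, 0) * monomial s c = monomial (s + Finsupp.single (0, 0) 1) c := by
      rw [mul_comm, ← pow_one (X _ : MvPolynomial (Fin 2 × Fin 2) B), ← monomial_add_single]
    rw [rowEuler_monomial, ← succ_nsmul, pderiv_monomial, mul_smul_comm, map_nsmul, hX,
      haar_monomial, haar_monomial, mul_assoc, nsmul_eq_mul, mul_left_comm]
    congr 1
    have := congrArg (algebraMap ℂ B) (haarWeight_add_single_zero s)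
    simpa using this

lemma haarWeight_add_single_one (s : Fin 2 × Fin 2 →₀ ℕ) :
    ((s (1, 0) + s (1, 1) + 1 : ℕ) : ℂ) * haarWeight (s + Finsupp.single (0, 1) 1) =
      -(s (1, 0) * haarWeight (s - Finsupp.single (1, 0) 1)) := by
  simp only [haarWeight, Finsupp.add_apply, Finsupp.tsub_apply, Finsupp.single_apply]
  simp
  generalize s (0, 0) = a, s (0, 1) = b, s (1, 0) = c, s (1, 1) = d
  rcases c with _ | k
  · simp
  · simp only [Nat.add_sub_cancel, Nat.add_right_cancel_iff]
    split_ifs with h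
    · obtain ⟨rfl, rfl⟩ := h
      simp only [Nat.factorial_succ, pow_succ]
      have h1 : ((a + b).factorial : ℂ) ≠ 0 := by exact_mod_cast Nat.factorial_ne_zero _
      rw [show a + (b + 1) = a + b + 1 by ring]
      simp only [Nat.factorial_succ]
      have h2 : ((a : ℂ) + b + 1) ≠ 0 := by exact_mod_cast Nat.succ_ne_zero (a + b)
      have h3 : ((a : ℂ) + b + 1 + 1) ≠ 0 := by exact_mod_cast Nat.succ_ne_zero (a + b + 1)
      push_cast
      field_simp
      ring
    · simp

lemma haar_X_one_mul (F : MvPolynomial (Fin 2 × Fin 2) B) :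
    haar B (X (0, 1) * (rowEuler B 1 F + F)) = -haar B (pderiv (1, 0) F) := by
  induction F using MvPolynomial.induction_on' with
  | add p q hp hq =>
    rw [show X (0, 1) * (rowEuler B 1 (p + q) + (p + q)) =
      X (0, 1) * (rowEuler B 1 p + p) + X (0, 1) * (rowEuler B 1 q + q) by rw [map_add]; ring,
      map_add, hp, hq, map_add, map_add, neg_add]
  | monomial s c =>
    have hX : X (0, 1) * monomial s c = monomial (s + Finsupp.single (0, 1) 1) c := by
      rw [mul_comm, ← pow_one (X _ : MvPolynomial (Fin 2 × Fin 2) B), ← monomial_add_single]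
    rw [rowEuler_monomial, ← succ_nsmul, pderiv_monomial, mul_smul_comm, map_nsmul, hX,
      haar_monomial, haar_monomial, mul_assoc, nsmul_eq_mul, mul_left_comm, ← mul_neg]
    congr 1
    have := congrArg (algebraMap ℂ B) (haarWeight_add_single_one s)
    simpa using this

lemma haar_rowForm_mul (c : Fin 2 → B) (F : MvPolynomial (Fin 2 × Fin 2) B) :
    haar B (rowForm 0 c * (rowEuler B 1 F + F)) = haar B (rowDeriv c F) := by
  have e : rowForm 0 c * (rowEuler B 1 F + F) =
      c 0 • (X (0, 0) * (rowEuler B 1 F + F)) + c 1 • (X (0, 1) * (rowEuler B 1 F + F)) := by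
    simp only [rowForm, smul_eq_C_mul]; ring
  rw [e, map_add, map_smul, map_smul, haar_X_zero_mul, haar_X_one_mul]
  simp [rowDeriv, sub_eq_add_neg]

lemma mem_of_nsmul_mem (S : Subalgebra ℂ B) (k : ℕ) (x : B) (h : (k + 1) • x ∈ S) : x ∈ S := by
  have h1 : x = ((k + 1 : ℂ)⁻¹) • ((k + 1) • x) := by
    rw [← Nat.cast_smul_eq_nsmul ℂ, smul_smul]
    push_cast
    rw [inv_mul_cancel₀ (by exact_mod_cast Nat.succ_ne_zero k), one_smul]
  rw [h1]
  exact S.smul_mem h _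

/-- The invariant functional sends a product of linear forms in the two rows to a polynomial in
the brackets of their coefficient vectors. -/
lemma haar_prod_rowForm_mem (S : Subalgebra ℂ B) (T : Set (Fin 2 → B))
    (hT : ∀ c ∈ T, ∀ d ∈ T, c 0 * d 1 - c 1 * d 0 ∈ S) (l₀ l₁ : List (Fin 2 → B))
    (h₀ : ∀ c ∈ l₀, c ∈ T) (h₁ : ∀ c ∈ l₁, c ∈ T) :
    haar B ((l₀.map (rowForm 0)).prod * (l₁.map (rowForm 1)).prod) ∈ S := by
  induction l₀ generalizing l₁ with
  | nil =>
    cases l₁ with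
    | nil => simp [haar_one]
    | cons d l =>
      have h := haar_rowEuler (((d :: l).map (rowForm 1)).prod : MvPolynomial (Fin 2 × Fin 2) B)
      rw [rowEuler_prod_rowForm, rowEuler_prod_rowForm] at h
      simp only [zero_ne_one, if_false, zero_smul, map_zero, if_true, List.length_cons,
        map_nsmul] at h
      refine mem_of_nsmul_mem S l.length _ ?_
      rw [List.map_nil, List.prod_nil, one_mul, ← h]
      exact S.zero_mem
  | cons c l₀ ih =>
    have hl₀ : ∀ c ∈ l₀, c ∈ T := fun c hc => h₀ c (List.mem_cons_of_mem _ hc)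
    have key : ∀ todo done : List (Fin 2 → B), (∀ c ∈ todo, c ∈ T) → (∀ c ∈ done, c ∈ T) →
        haar B ((l₀.map (rowForm 0)).prod * (done.map (rowForm 1)).prod *
          rowDeriv c (todo.map (rowForm 1)).prod) ∈ S := by
      intro todo
      induction todo with
      | nil => simp
      | cons d todo ih' =>
        intro done htodo hdone
        have hd := htodo d List.mem_cons_self
        have htodo' : ∀ c ∈ todo, c ∈ T := fun c hc => htodo c (List.mem_cons_of_mem _ hc)
        have e : (l₀.map (rowForm 0)).prod * (done.map (rowForm 1)).prod *
            rowDeriv c ((d :: todo).map (rowForm 1)).prod =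
            (l₀.map (rowForm 0)).prod * ((d :: done).map (rowForm 1)).prod *
              rowDeriv c (todo.map (rowForm 1)).prod +
            (c 0 * d 1 - c 1 * d 0) • ((l₀.map (rowForm 0)).prod *
              ((done ++ todo).map (rowForm 1)).prod) := by
          simp only [List.map_cons, List.prod_cons, Derivation.leibniz, rowDeriv_rowForm_one,
            List.map_append, List.prod_append, smul_eq_C_mul, smul_eq_mul]
          ring
        rw [e, map_add, map_smul]
        refine S.add_mem (ih' _ htodo' ?_) (S.mul_mem (hT c (h₀ c List.mem_cons_self) d hd)
          (ih _ hl₀ ?_))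
        · simpa [hd] using hdone
        · intro x hx
          rcases List.mem_append.1 hx with hx | hx
          exacts [hdone x hx, htodo' x hx]
    have h := haar_rowForm_mul c ((l₀.map (rowForm 0)).prod * (l₁.map (rowForm 1)).prod)
    have e : rowEuler B 1 ((l₀.map (rowForm 0)).prod * (l₁.map (rowForm 1)).prod) +
        (l₀.map (rowForm 0)).prod * (l₁.map (rowForm 1)).prod =
        (l₁.length + 1) • ((l₀.map (rowForm 0)).prod * (l₁.map (rowForm 1)).prod) := by
      rw [Derivation.leibniz, rowEuler_prod_rowForm, rowEuler_prod_rowForm]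
      simp [add_mul]
      ring
    rw [e, mul_smul_comm, map_nsmul, Derivation.leibniz, rowDeriv_prod_rowForm_zero, smul_zero,
      add_zero] at h
    refine mem_of_nsmul_mem S l₁.length _ ?_
    rw [List.map_cons, List.prod_cons, mul_assoc, h]
    simpa using key l₁ [] h₁ (by simp)

end Haar

/-! ### Linear substitutions in binary forms -/

/-- The substitution `x_i ↦ ∑ j, A i j • x_j`. -/
def linSub {R : Type} [CommRing R] (A : Matrix (Fin 2) (Fin 2) R) :
    MvPolynomial (Fin 2) R →ₐ[R] MvPolynomial (Fin 2) R :=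
  aeval fun i => ∑ j : Fin 2, C (A i j) * X j

lemma linSub_linSub {R : Type} [CommRing R] (A B : Matrix (Fin 2) (Fin 2) R)
    (p : MvPolynomial (Fin 2) R) : linSub A (linSub B p) = linSub (B * A) p := by
  have h : (linSub A).comp (linSub B) = linSub (B * A) := by
    refine MvPolynomial.algHom_ext fun i => ?_
    simp [linSub, Matrix.mul_apply, MvPolynomial.algHom_C, MvPolynomial.algebraMap_eq]
    ring
  exact DFunLike.congr_fun h p

lemma subst2_eq_linSub (g : SL2) : subst2 g = linSub (g⁻¹).1 := rfl

lemma isHomogeneous_linSub {R : Type} [CommRing R] (A : Matrix (Fin 2) (Fin 2) R)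
    {p : MvPolynomial (Fin 2) R} {n : ℕ} (hp : p.IsHomogeneous n) :
    (linSub A p).IsHomogeneous n := by
  have := hp.aeval (R := R) (fun i => ∑ j : Fin 2, C (A i j) * X j) (n := 1) (fun i =>
    IsHomogeneous.sum _ _ _ fun j _ => by
      simpa using (isHomogeneous_C (Fin 2) (A i j)).mul (isHomogeneous_X R j))
  simpa [linSub] using this

lemma isHomogeneous_form (n : ℕ) (a : Fin (n + 1) → ℂ) : (form n a).IsHomogeneous n := by
  refine IsHomogeneous.sum _ _ _ fun i _ => ?_
  have := ((isHomogeneous_C (Fin 2) (a i)).mul ((isHomogeneous_X ℂ 0).pow (n - (i : ℕ)))).mul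
    ((isHomogeneous_X ℂ (1 : Fin 2)).pow (i : ℕ))
  convert this using 1
  omega

lemma form_term_eq_monomial {R : Type} [CommRing R] (i j : ℕ) (c : R) :
    C c * X 0 ^ i * X 1 ^ j =
      monomial (Finsupp.single (0 : Fin 2) i + Finsupp.single 1 j) c := by
  rw [C_mul_X_pow_eq_monomial, X_pow_eq_monomial, monomial_mul, mul_one]

lemma coeff_form_sum {R : Type} [CommRing R] (n : ℕ) (a : Fin (n + 1) → R) (k : Fin (n + 1)) :
    coeff (Finsupp.single (0 : Fin 2) (n - (k : ℕ)) + Finsupp.single 1 (k : ℕ))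
      (∑ i : Fin (n + 1), C (a i) * X 0 ^ (n - (i : ℕ)) * X 1 ^ (i : ℕ)) = a k := by
  rw [coeff_sum, Finset.sum_eq_single k]
  · rw [form_term_eq_monomial, coeff_monomial, if_pos rfl]
  · intro i _ hi
    rw [form_term_eq_monomial, coeff_monomial, if_neg]
    intro h
    have := DFunLike.congr_fun h 1
    simp at this
    exact hi (Fin.ext this)
  · simp

lemma form_coeffOf {n : ℕ} {p : MvPolynomial (Fin 2) ℂ} (hp : p.IsHomogeneous n) :
    form n (coeffOf n p) = p := by
  ext s
  by_cases hs : s 0 + s 1 = n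
  · have h1 : s = Finsupp.single 0 (n - (⟨s 1, by omega⟩ : Fin (n + 1)).1) +
        Finsupp.single 1 (⟨s 1, by omega⟩ : Fin (n + 1)).1 := by
      ext i; fin_cases i
      · simp; omega
      · simp
    rw [h1]
    exact coeff_form_sum n _ _
  · have hd : s.degree ≠ n := by
      rwa [Finsupp.degree_eq_sum, Fin.sum_univ_two]
    rw [hp.coeff_eq_zero hd, (isHomogeneous_form n _).coeff_eq_zero hd]

/-- The coefficients of a form after the substitution `A`. -/
def coeffSub (A : Matrix (Fin 2) (Fin 2) ℂ) (n : ℕ) (a : Fin (n + 1) → ℂ) : Fin (n + 1) → ℂ :=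
  coeffOf n (linSub A (form n a))

lemma coeffSub_coeffAct (g : SL2) (A : Matrix (Fin 2) (Fin 2) ℂ) (n : ℕ) (a : Fin (n + 1) → ℂ) :
    coeffSub (g.1 * A) n (coeffAct g n a) = coeffSub A n a := by
  have hg : (g⁻¹).1 * g.1 = 1 := by
    rw [← Matrix.SpecialLinearGroup.coe_mul, inv_mul_cancel, Matrix.SpecialLinearGroup.coe_one]
  rw [coeffSub, coeffSub, coeffAct, subst2_eq_linSub,
    form_coeffOf (isHomogeneous_linSub _ (isHomogeneous_form n a)), linSub_linSub, ← mul_assoc,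
    hg, one_mul]

lemma coeffAct_eq_sum (g : SL2) (n : ℕ) (a : Fin (n + 1) → ℂ) (k : Fin (n + 1)) :
    coeffAct g n a k = ∑ j, coeffAct g n (Pi.single j 1) k * a j := by
  have h1 : ∀ a, form n a = ∑ j, a j • form n (Pi.single j 1) := by
    intro a
    refine Finset.sum_congr rfl fun i _ => ?_
    rw [form, Finset.sum_eq_single i]
    · simp [smul_eq_C_mul, mul_assoc]
    · intro j _ hj; simp [hj]
    · simp
  simp only [coeffAct, coeffOf]
  rw [h1 a, map_sum, coeff_sum]
  refine Finset.sum_congr rfl fun j _ => ?_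
  rw [map_smul, coeff_smul, smul_eq_mul, mul_comm]

/-! ### The action of `SL(2)` on polynomials in several points -/

section TensorAction

variable {ι : Type} (ν : ι → ℕ)

/-- The action of `g` on points of `V ⊕ (ℂ²)³`. -/
def ptActT (g : SL2) (pt : TVar ν → ℂ) : TVar ν → ℂ :=
  Sum.elim
    (fun c => coeffAct g (ν c.1) (fun k => pt (Sum.inl ⟨c.1, k⟩)) c.2)
    (fun v => ∑ j : Fin 2, (g).1 v.2 j * pt (Sum.inr (v.1, j)))

/-- The action of `g` on polynomial functions by precomposition. -/
def actT (g : SL2) : TRing ν →ₐ[ℂ] TRing ν :=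
  aeval (Sum.elim
    (fun c => ∑ j, C (coeffAct g (ν c.1) (Pi.single j 1) c.2) * X (Sum.inl ⟨c.1, j⟩))
    (fun v => ∑ j : Fin 2, C ((g).1 v.2 j) * X (Sum.inr (v.1, j))))

lemma eval_actT (g : SL2) (pt : TVar ν → ℂ) (p : TRing ν) :
    eval pt (actT ν g p) = eval (ptActT ν g pt) p := by
  have h : (aeval pt : TRing ν →ₐ[ℂ] ℂ).comp (actT ν g) = aeval (ptActT ν g pt) := by
    refine MvPolynomial.algHom_ext fun v => ?_
    rcases v with c | v
    · simp [actT, ptActT, ← coeffAct_eq_sum]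
    · simp [actT, ptActT]
  simpa [aeval_eq_eval] using DFunLike.congr_fun h p

lemma pderiv_actT (g : SL2) (a : Fin 3) (j : Fin 2) (p : TRing ν) :
    pderiv (Sum.inr (a, j)) (actT ν g p) =
      ∑ i : Fin 2, C ((g).1 i j) * actT ν g (pderiv (Sum.inr (a, i)) p) := by
  induction p using MvPolynomial.induction_on with
  | C r => simp [MvPolynomial.algHom_C, MvPolynomial.algebraMap_eq]
  | add p q hp hq => simp only [map_add, hp, hq, mul_add, Finset.sum_add_distrib]
  | mul_X p v hp =>
    have hv : pderiv (Sum.inr (a, j)) (actT ν g (X v)) =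
        ∑ i : Fin 2, C ((g).1 i j) * actT ν g (pderiv (Sum.inr (a, i)) (X v)) := by
      rcases v with c | ⟨b, k⟩
      · simp [actT]
      · simp only [actT, aeval_X, Sum.elim_inr, Fin.sum_univ_two, map_add, Derivation.leibniz,
          pderiv_C]
        by_cases hab : a = b
        · subst hab
          fin_cases j <;> fin_cases k <;> simp
        · have hba : b ≠ a := fun h => hab h.symm
          simp [hba]
    simp only [map_mul, Derivation.leibniz, map_add, hp, hv, smul_eq_mul, Fin.sum_univ_two]
    ring

/-- The polarization operator `x_a · ∂/∂x_b`. -/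
def polar (a b : Fin 3) : Derivation ℂ (TRing ν) (TRing ν) :=
  (X (Sum.inr (a, 0)) : TRing ν) • pderiv (Sum.inr (b, 0)) +
    (X (Sum.inr (a, 1)) : TRing ν) • pderiv (Sum.inr (b, 1))

lemma polar_apply (a b : Fin 3) (p : TRing ν) :
    polar ν a b p = X (Sum.inr (a, 0)) * pderiv (Sum.inr (b, 0)) p +
      X (Sum.inr (a, 1)) * pderiv (Sum.inr (b, 1)) p := rfl

lemma SigmaT_apply (a : Fin 3) (p : TRing ν) : SigmaT ν a p = polar ν 0 a p := rfl

lemma OmegaT_apply (a b : Fin 3) (p : TRing ν) : OmegaT ν a b p =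
    pderiv (Sum.inr (a, 0)) (pderiv (Sum.inr (b, 1)) p) -
      pderiv (Sum.inr (a, 1)) (pderiv (Sum.inr (b, 0)) p) := rfl

lemma actT_polar (g : SL2) (a b : Fin 3) (p : TRing ν) :
    actT ν g (polar ν a b p) = polar ν a b (actT ν g p) := by
  simp only [polar_apply, pderiv_actT, map_add, map_mul, Fin.sum_univ_two]
  simp only [actT, aeval_X, Sum.elim_inr, Fin.sum_univ_two]
  ring

lemma actT_OmegaT (g : SL2) (a b : Fin 3) (p : TRing ν) :
    actT ν g (OmegaT ν a b p) = OmegaT ν a b (actT ν g p) := by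
  have hd : C (g.1 0 0) * C (g.1 1 1) - C (g.1 0 1) * C (g.1 1 0) = (1 : TRing ν) := by
    rw [← C_mul, ← C_mul, ← C_sub, ← Matrix.det_fin_two, g.2, C_1]
  simp only [OmegaT_apply, pderiv_actT, map_add, Derivation.leibniz, map_sub, pderiv_C,
    smul_eq_mul, Fin.sum_univ_two]
  linear_combination (-(actT ν g (pderiv (Sum.inr (a, 0)) (pderiv (Sum.inr (b, 1)) p)) -
    actT ν g (pderiv (Sum.inr (a, 1)) (pderiv (Sum.inr (b, 0)) p)))) * hd

/-- The invariant polynomial functions on `V ⊕ (ℂ²)³`. -/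
def InvT : Subalgebra ℂ (TRing ν) :=
  ⨅ g : SL2, AlgHom.equalizer (actT ν g) (AlgHom.id ℂ (TRing ν))

variable {ν}

lemma mem_InvT {p : TRing ν} : p ∈ InvT ν ↔ ∀ g, actT ν g p = p := by
  simp [InvT, Algebra.mem_iInf, AlgHom.mem_equalizer]

lemma mem_InvT_of_eval {p : TRing ν} (h : ∀ g pt, eval (ptActT ν g pt) p = eval pt p) :
    p ∈ InvT ν :=
  mem_InvT.2 fun g => MvPolynomial.funext fun pt => by rw [eval_actT, h]

lemma eval_ptActT_of_mem {p : TRing ν} (hp : p ∈ InvT ν) (g : SL2) (pt : TVar ν → ℂ) :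
    eval (ptActT ν g pt) p = eval pt p := by
  rw [← eval_actT, mem_InvT.1 hp]

lemma polar_mem_InvT {p : TRing ν} (hp : p ∈ InvT ν) (a b : Fin 3) : polar ν a b p ∈ InvT ν :=
  mem_InvT.2 fun g => by rw [actT_polar, mem_InvT.1 hp]

lemma OmegaT_mem_InvT {p : TRing ν} (hp : p ∈ InvT ν) (a b : Fin 3) : OmegaT ν a b p ∈ InvT ν :=
  mem_InvT.2 fun g => by rw [actT_OmegaT, mem_InvT.1 hp]

lemma pow_apply_mem_InvT {p : TRing ν} (hp : p ∈ InvT ν) (T : Module.End ℂ (TRing ν))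
    (hT : ∀ q ∈ InvT ν, T q ∈ InvT ν) (k : ℕ) : (T ^ k) p ∈ InvT ν := by
  induction k with
  | zero => simpa using hp
  | succ k ih => rw [pow_succ', Module.End.mul_apply]; exact hT _ ih

lemma embT_mem_InvT {p : CoordRing ν} (hp : p ∈ Covariants ν) (a : Fin 3) :
    embT ν a p ∈ InvT ν := by
  refine mem_InvT_of_eval fun g pt => ?_
  have h := hp g (pt ∘ Sum.map id fun i => (a, i))
  rw [embT, eval_rename, eval_rename, ← h]
  congr 2
  funext v
  rcases v with c | i <;> simp [ptActT, ptAct]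

lemma collapseT_mem_Covariants {p : TRing ν} (hp : p ∈ InvT ν) : collapseT ν p ∈ Covariants ν := by
  have e : ∀ pt : Var ν → ℂ, eval pt (collapseT ν p) =
      eval (Sum.elim (fun c => pt (Sum.inl c)) fun v => pt (Sum.inr v.2)) p := by
    intro pt
    have h : (aeval pt : CoordRing ν →ₐ[ℂ] ℂ).comp (collapseT ν) =
        aeval (Sum.elim (fun c => pt (Sum.inl c)) fun v => pt (Sum.inr v.2)) := by
      refine MvPolynomial.algHom_ext fun v => ?_
      rcases v with c | v <;> simp [collapseT]
    simpa [aeval_eq_eval] using DFunLike.congr_fun h p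
  intro g pt
  rw [e, e, ← eval_ptActT_of_mem hp g (Sum.elim (fun c => pt (Sum.inl c)) _)]
  congr 2

variable (ν)

/-- A point of `V ⊕ ℂ²` as a point of `V ⊕ (ℂ²)³` with vanishing second and third vectors. -/
def liftPt (pt : Var ν → ℂ) : TVar ν → ℂ :=
  Sum.elim (fun c => pt (Sum.inl c)) fun v => if v.1 = 0 then pt (Sum.inr v.2) else 0

/-- The restriction to vanishing second and third vectors. -/
def evZero : TRing ν →ₐ[ℂ] CoordRing ν :=
  aeval (Sum.elim (fun c => X (Sum.inl c)) fun v => if v.1 = 0 then X (Sum.inr v.2) else 0)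

variable {ν}

lemma eval_evZero (pt : Var ν → ℂ) (p : TRing ν) :
    eval pt (evZero ν p) = eval (liftPt ν pt) p := by
  have h : (aeval pt : CoordRing ν →ₐ[ℂ] ℂ).comp (evZero ν) = aeval (liftPt ν pt) := by
    refine MvPolynomial.algHom_ext fun v => ?_
    rcases v with c | ⟨a, i⟩
    · simp [evZero, liftPt]
    · by_cases h : a = 0 <;> simp [evZero, liftPt, h]
  simpa [aeval_eq_eval] using DFunLike.congr_fun h p

lemma ptActT_liftPt (g : SL2) (pt : Var ν → ℂ) :
    ptActT ν g (liftPt ν pt) = liftPt ν (ptAct ν g pt) := by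
  funext v
  rcases v with c | ⟨a, i⟩
  · simp [ptActT, liftPt, ptAct]
  · by_cases h : a = 0 <;> simp [ptActT, liftPt, ptAct, h]

lemma evZero_mem_Covariants {p : TRing ν} (hp : p ∈ InvT ν) : evZero ν p ∈ Covariants ν := by
  intro g pt
  rw [eval_evZero, eval_evZero, ← ptActT_liftPt, eval_ptActT_of_mem hp]

lemma transvect_mem_Covariants {U W : CoordRing ν} (hU : U ∈ Covariants ν)
    (hW : W ∈ Covariants ν) (u₀ w₀ r : ℕ) : transvect ν u₀ w₀ r U W ∈ Covariants ν := by
  rw [transvect]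
  split_ifs
  · refine collapseT_mem_Covariants ?_
    refine pow_apply_mem_InvT ?_ _ (fun q hq => OmegaT_mem_InvT hq 1 2) r
    refine pow_apply_mem_InvT ?_ _ (fun q hq => polar_mem_InvT hq 0 1) _
    refine pow_apply_mem_InvT ?_ _ (fun q hq => polar_mem_InvT hq 0 2) _
    exact mul_mem (embT_mem_InvT hU 1) (embT_mem_InvT hW 2)
  · exact zero_mem _

end TensorAction

lemma embL_mem_Covariants {ι₁ ι₂ : Type} (n : ι₁ → ℕ) (m : ι₂ → ℕ) {p : CoordRing n}
    (hp : p ∈ Covariants n) : embL n m p ∈ Covariants (Sum.elim n m) := by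
  intro g pt
  rw [embL, eval_rename, eval_rename, ← hp g (pt ∘ _)]
  congr 2
  funext v
  rcases v with c | i <;> rfl

lemma embR_mem_Covariants {ι₁ ι₂ : Type} (n : ι₁ → ℕ) (m : ι₂ → ℕ) {p : CoordRing m}
    (hp : p ∈ Covariants m) : embR n m p ∈ Covariants (Sum.elim n m) := by
  intro g pt
  rw [embR, eval_rename, eval_rename, ← hp g (pt ∘ _)]
  congr 2
  funext v
  rcases v with c | i <;> rfl

/-! ### Polarization calculus and the Gordan expansion -/

section Gordan

variable {ι : Type} {ν : ι → ℕ}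

lemma polar_X (a b c : Fin 3) (i : Fin 2) :
    polar ν a b (X (Sum.inr (c, i))) = if b = c then X (Sum.inr (a, i)) else 0 := by
  rw [polar_apply]
  by_cases h : b = c
  · subst h
    fin_cases i <;> simp
  · have h' : c ≠ b := fun e => h e.symm
    simp [h, h']

lemma polar_X_inl (a b : Fin 3) (c : Σ i : ι, Fin (ν i + 1)) :
    polar ν a b (X (Sum.inl c)) = 0 := by
  simp [polar_apply]

lemma polar_pderiv (a b c : Fin 3) (i : Fin 2) (p : TRing ν) :
    polar ν a b (pderiv (Sum.inr (c, i)) p) = pderiv (Sum.inr (c, i)) (polar ν a b p) -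
      if a = c then pderiv (Sum.inr (b, i)) p else 0 := by
  have h : ⁅polar ν a b, (pderiv (Sum.inr (c, i)) : Derivation ℂ (TRing ν) (TRing ν))⁆ =
      if a = c then -pderiv (R := ℂ) (Sum.inr (b, i)) else 0 := by
    refine MvPolynomial.derivation_ext fun v => ?_
    rw [Derivation.commutator_apply]
    rcases v with d | ⟨d, j⟩
    · rw [polar_X_inl]
      split_ifs <;> simp
    · rw [polar_X]
      have h1 : ∀ x y : Fin 3, pderiv (Sum.inr (x, i)) (X (Sum.inr (y, j)) : TRing ν) =
          if x = y then (if i = j then 1 else 0) else 0 := by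
        intro x y
        by_cases h3 : x = y ∧ i = j
        · obtain ⟨rfl, rfl⟩ := h3
          simp
        · rw [pderiv_X_of_ne (by simpa [eq_comm] using h3)]
          split_ifs <;> simp_all
      have h2 : polar ν a b (pderiv (Sum.inr (c, i)) (X (Sum.inr (d, j)))) = 0 := by
        rw [h1]
        split_ifs <;> simp
      rw [h2, zero_sub]
      by_cases h4 : a = c
      · subst h4
        by_cases h3 : b = d <;> simp [h3, h1]
      · by_cases h3 : b = d <;> simp [h3, h4, h1, Ne.symm h4]
  have h' := DFunLike.congr_fun h p
  rw [Derivation.commutator_apply] at h'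
  split_ifs at h' ⊢
  · rw [Derivation.neg_apply] at h'
    linear_combination h'
  · rw [Derivation.zero_apply] at h'
    linear_combination h'

lemma polar_polar (a b c d : Fin 3) (p : TRing ν) :
    polar ν a b (polar ν c d p) = polar ν c d (polar ν a b p) +
      (if b = c then polar ν a d p else 0) - if a = d then polar ν c b p else 0 := by
  have h : ⁅polar ν a b, polar ν c d⁆ =
      (if b = c then polar ν a d else 0) - if a = d then polar ν c b else 0 := by
    refine MvPolynomial.derivation_ext fun v => ?_
    rw [Derivation.commutator_apply]
    rcases v with e | ⟨e, j⟩
    · rw [polar_X_inl, polar_X_inl]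
      split_ifs <;> simp [polar_X_inl]
    · rw [polar_X, polar_X]
      have h1 : ∀ x y z w : Fin 3, polar ν x y (if z = e then X (Sum.inr (w, j)) else 0) =
          if z = e then (if y = w then X (Sum.inr (x, j)) else 0) else 0 := by
        intro x y z w
        split_ifs with h1 h2 <;> simp [polar_X, *]
      have h2 : ∀ (P : Prop) [Decidable P] (x y : Fin 3),
          (if P then polar ν x y else 0) (X (Sum.inr (e, j))) =
            if P then (if y = e then X (Sum.inr (x, j)) else 0) else 0 := by
        intro P _ x y
        split_ifs with h1 h2 <;> simp [polar_X, *]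
      rw [Derivation.sub_apply, h1, h1, h2, h2]
      congr 1
      · split_ifs <;> rfl
      · by_cases h3 : a = d
        · subst h3; simp
        · simp [h3, Ne.symm h3]
  have h' := DFunLike.congr_fun h p
  rw [Derivation.commutator_apply] at h'
  split_ifs at h' ⊢ <;> simp at h' ⊢ <;> linear_combination h'

open Classical in
lemma coeff_polar_self (a : Fin 3) (p : TRing ν) (s : TVar ν →₀ ℕ) :
    coeff s (polar ν a a p) =
      ((s (Sum.inr (a, 0)) + s (Sum.inr (a, 1)) : ℕ) : ℂ) * coeff s p := by
  induction p using MvPolynomial.induction_on' with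
  | add p q hp hq => rw [map_add, coeff_add, coeff_add, hp, hq, mul_add]
  | monomial t c =>
    rw [polar_apply, X_mul_pderiv_monomial, X_mul_pderiv_monomial, ← add_smul, coeff_smul,
      coeff_monomial]
    split_ifs with h
    · subst h; simp
    · simp

lemma degree_eq_of_polar_self {a : Fin 3} {p : TRing ν} {d : ℕ} (hp : polar ν a a p = d • p)
    {s : TVar ν →₀ ℕ} (hs : s ∈ p.support) : s (Sum.inr (a, 0)) + s (Sum.inr (a, 1)) = d := by
  have h := coeff_polar_self a p s
  rw [hp, coeff_smul, nsmul_eq_mul] at h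
  exact_mod_cast (mul_right_cancel₀ (mem_support_iff.1 hs) h).symm

lemma notMem_vars_of_polar_self {a : Fin 3} {p : TRing ν} (hp : polar ν a a p = 0) (i : Fin 2) :
    Sum.inr (a, i) ∉ p.vars := by
  intro h
  obtain ⟨s, hs, hi⟩ := (mem_vars_iff_mem_support _).1 h
  have hd := degree_eq_of_polar_self (d := 0) (by rw [hp, zero_smul]) hs
  rw [Finsupp.mem_support_iff] at hi
  fin_cases i <;> simp at hi <;> omega

lemma polar_self_pderiv {a : Fin 3} {p : TRing ν} {d : ℕ} (hp : polar ν a a p = d • p)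
    (i : Fin 2) : polar ν a a (pderiv (Sum.inr (a, i)) p) =
      (d - 1) • pderiv (Sum.inr (a, i)) p := by
  rcases d with _ | d
  · rw [pderiv_eq_zero_of_notMem_vars (notMem_vars_of_polar_self (by rw [hp, zero_smul]) i)]
    simp
  · rw [polar_pderiv, hp, if_pos rfl, map_nsmul, succ_nsmul]
    simp

lemma polar_self_pderiv_of_ne {a c : Fin 3} (hac : a ≠ c) {p : TRing ν} {d : ℕ}
    (hp : polar ν a a p = d • p) (i : Fin 2) : polar ν a a (pderiv (Sum.inr (c, i)) p) =
      d • pderiv (Sum.inr (c, i)) p := by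
  rw [polar_pderiv, hp, if_neg hac, map_nsmul, sub_zero]

lemma polar_self_OmegaT_left {a b : Fin 3} (hab : a ≠ b) {p : TRing ν} {d : ℕ}
    (hp : polar ν a a p = d • p) : polar ν a a (OmegaT ν a b p) = (d - 1) • OmegaT ν a b p := by
  rw [OmegaT_apply, map_sub, polar_self_pderiv (polar_self_pderiv_of_ne hab hp _),
    polar_self_pderiv (polar_self_pderiv_of_ne hab hp _), smul_sub]

lemma polar_self_OmegaT_right {a b : Fin 3} (hab : a ≠ b) {p : TRing ν} {d : ℕ}
    (hp : polar ν b b p = d • p) : polar ν b b (OmegaT ν a b p) = (d - 1) • OmegaT ν a b p := by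
  rw [OmegaT_apply, map_sub, polar_self_pderiv_of_ne hab.symm (polar_self_pderiv hp _),
    polar_self_pderiv_of_ne hab.symm (polar_self_pderiv hp _), smul_sub]

/-- Capelli's identity for two vectors. -/
lemma capelli (p : TRing ν) :
    polar ν 0 0 (polar ν 1 1 p) + polar ν 1 1 p =
      (X (Sum.inr (0, 0)) * X (Sum.inr (1, 1)) - X (Sum.inr (0, 1)) * X (Sum.inr (1, 0))) *
        OmegaT ν 0 1 p + polar ν 1 0 (polar ν 0 1 p) := by
  rw [OmegaT_apply, polar_apply ν 1 1, polar_apply ν 0 1]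
  simp only [map_add, Derivation.leibniz, polar_X, smul_eq_mul]
  simp only [polar_apply]
  simp
  ring

end Gordan

section GenericSubstitution

/-- Graded behaviour of the coefficients of a binary form under a derivation `E`. -/
def CoeffGraded {R : Type} [CommRing R] [Algebra ℂ R] (E : Derivation ℂ R R) (i : Fin 2)
    (P : MvPolynomial (Fin 2) R) : Prop :=
  ∀ s, E (coeff s P) = s i • coeff s P

namespace CoeffGraded

variable {R : Type} [CommRing R] [Algebra ℂ R] {E : Derivation ℂ R R} {i : Fin 2}
  {P Q : MvPolynomial (Fin 2) R}

lemma add (hP : CoeffGraded E i P) (hQ : CoeffGraded E i Q) : CoeffGraded E i (P + Q) :=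
  fun s => by rw [coeff_add, map_add, hP, hQ, smul_add]

lemma mul (hP : CoeffGraded E i P) (hQ : CoeffGraded E i Q) : CoeffGraded E i (P * Q) := by
  intro s
  rw [coeff_mul, map_sum, Finset.smul_sum]
  refine Finset.sum_congr rfl fun x hx => ?_
  rw [Derivation.leibniz, hP, hQ, ← Finset.HasAntidiagonal.mem_antidiagonal.1 hx, Finsupp.add_apply]
  simp only [smul_eq_mul, nsmul_eq_mul]
  push_cast
  ring

lemma const {c : R} (hc : E c = 0) : CoeffGraded E i (C c) := by
  intro s
  rw [coeff_C]
  split_ifs with h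
  · subst h; simp [hc]
  · simp

lemma C_mul_X {c : R} {j : Fin 2} (hc : E c = if i = j then c else 0) :
    CoeffGraded E i (C c * X j) := by
  intro s
  rw [coeff_C_mul, coeff_X]
  split_ifs with h
  · subst h
    rw [mul_one, hc]
    split_ifs with hij
    · subst hij; simp
    · simp [Ne.symm hij]
  · simp

lemma pow (hP : CoeffGraded E i P) (k : ℕ) : CoeffGraded E i (P ^ k) := by
  induction k with
  | zero => simpa using const (i := i) E.map_one_eq_zero
  | succ k ih => rw [pow_succ]; exact ih.mul hP

lemma sum {κ : Type} (t : Finset κ) (F : κ → MvPolynomial (Fin 2) R)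
    (hF : ∀ k ∈ t, CoeffGraded E i (F k)) : CoeffGraded E i (∑ k ∈ t, F k) := by
  intro s
  rw [coeff_sum, map_sum, Finset.smul_sum]
  exact Finset.sum_congr rfl fun k hk => hF k hk s

end CoeffGraded

variable {ι : Type} (ν : ι → ℕ)

/-- The linear form `u_r x + v_r y` with coefficients in the `r`-th coordinates of two vectors. -/
def genRow (r : Fin 2) : MvPolynomial (Fin 2) (TRing ν) :=
  C (X (Sum.inr (0, r))) * X 0 + C (X (Sum.inr (1, r))) * X 1

/-- The generic form in the variables `u x + v y`. -/
def genForm (i : ι) : MvPolynomial (Fin 2) (TRing ν) :=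
  ∑ j : Fin (ν i + 1), C (X (Sum.inl ⟨i, j⟩)) * genRow ν 0 ^ (ν i - (j : ℕ)) *
    genRow ν 1 ^ (j : ℕ)

/-- Replacement of the coefficients of the generic forms by those of the generic forms in the
variables `u x + v y`. -/
def genSub : MvPolynomial (Σ i : ι, Fin (ν i + 1)) ℂ →ₐ[ℂ] TRing ν :=
  aeval fun c => coeff (Finsupp.single 0 (ν c.1 - (c.2 : ℕ)) + Finsupp.single 1 (c.2 : ℕ))
    (genForm ν c.1)

variable {ν}

lemma coeffGraded_genForm_zero (i : ι) : CoeffGraded (polar ν 0 0) 0 (genForm ν i) := by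
  have h : ∀ r, CoeffGraded (polar ν 0 0) 0 (genRow ν r) := fun r =>
    (CoeffGraded.C_mul_X (by simp [polar_X])).add (CoeffGraded.C_mul_X (by simp [polar_X]))
  exact CoeffGraded.sum _ _ fun k _ =>
    ((CoeffGraded.const (polar_X_inl _ _ _)).mul ((h 0).pow _)).mul ((h 1).pow _)

lemma coeffGraded_genForm_one (i : ι) : CoeffGraded (polar ν 1 1) 1 (genForm ν i) := by
  have h : ∀ r, CoeffGraded (polar ν 1 1) 1 (genRow ν r) := fun r =>
    (CoeffGraded.C_mul_X (by simp [polar_X])).add (CoeffGraded.C_mul_X (by simp [polar_X]))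
  exact CoeffGraded.sum _ _ fun k _ =>
    ((CoeffGraded.const (polar_X_inl _ _ _)).mul ((h 0).pow _)).mul ((h 1).pow _)

lemma exists_polar_genSub_monomial (s : (Σ i : ι, Fin (ν i + 1)) →₀ ℕ) (z : ℂ) :
    ∃ c k : ℕ, polar ν 0 0 (genSub ν (monomial s z)) = c • genSub ν (monomial s z) ∧
      polar ν 1 1 (genSub ν (monomial s z)) = k • genSub ν (monomial s z) := by
  refine MvPolynomial.induction_on_monomial (motive := fun p => ∃ c k : ℕ,
    polar ν 0 0 (genSub ν p) = c • genSub ν p ∧ polar ν 1 1 (genSub ν p) = k • genSub ν p)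
    (fun a => ⟨0, 0, ?_⟩) (fun p c hp => ?_) s z
  · simp [MvPolynomial.algHom_C, MvPolynomial.algebraMap_eq]
  · obtain ⟨a, b, ha, hb⟩ := hp
    have hX : genSub ν (X c) = coeff (Finsupp.single 0 (ν c.1 - (c.2 : ℕ)) +
        Finsupp.single 1 (c.2 : ℕ)) (genForm ν c.1) := by rw [genSub, aeval_X]
    obtain ⟨e₀, h₀⟩ : ∃ e : ℕ, polar ν 0 0 (genSub ν (X c)) = e • genSub ν (X c) :=
      ⟨_, by rw [hX]; exact coeffGraded_genForm_zero c.1 _⟩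
    obtain ⟨e₁, h₁⟩ : ∃ e : ℕ, polar ν 1 1 (genSub ν (X c)) = e • genSub ν (X c) :=
      ⟨_, by rw [hX]; exact coeffGraded_genForm_one c.1 _⟩
    refine ⟨a + e₀, b + e₁, ?_, ?_⟩
    · rw [map_mul, Derivation.leibniz, ha, h₀, add_smul]
      simp only [smul_eq_mul, nsmul_eq_mul]
      ring
    · rw [map_mul, Derivation.leibniz, hb, h₁, add_smul]
      simp only [smul_eq_mul, nsmul_eq_mul]
      ring

lemma map_eval_genForm (pt : TVar ν → ℂ) (i : ι) :
    MvPolynomial.map (eval pt) (genForm ν i) =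
      linSub (Matrix.of fun r j : Fin 2 => pt (Sum.inr (if j = 0 then 0 else 1, r)))
        (form (ν i) fun k => pt (Sum.inl ⟨i, k⟩)) := by
  simp [genForm, genRow, form, linSub, MvPolynomial.algHom_C, MvPolynomial.algebraMap_eq]

lemma eval_genSub (pt : TVar ν → ℂ) (p : MvPolynomial (Σ i : ι, Fin (ν i + 1)) ℂ) :
    eval pt (genSub ν p) = eval (fun c => coeffSub
      (Matrix.of fun r j : Fin 2 => pt (Sum.inr (if j = 0 then 0 else 1, r))) (ν c.1)
        (fun k => pt (Sum.inl ⟨c.1, k⟩)) c.2) p := by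
  have h : (aeval pt : TRing ν →ₐ[ℂ] ℂ).comp (genSub ν) = aeval (fun c => coeffSub
      (Matrix.of fun r j : Fin 2 => pt (Sum.inr (if j = 0 then 0 else 1, r))) (ν c.1)
        (fun k => pt (Sum.inl ⟨c.1, k⟩)) c.2) := by
    refine MvPolynomial.algHom_ext fun c => ?_
    simp only [AlgHom.comp_apply, genSub, aeval_X, aeval_eq_eval, coeffSub, coeffOf,
      ← map_eval_genForm, coeff_map]
  simpa [aeval_eq_eval] using DFunLike.congr_fun h p

lemma genSub_mem_InvT (p : MvPolynomial (Σ i : ι, Fin (ν i + 1)) ℂ) : genSub ν p ∈ InvT ν := by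
  refine mem_InvT_of_eval fun g pt => ?_
  rw [eval_genSub, eval_genSub]
  refine congrArg (fun x => eval x p) (funext fun c => ?_)
  rw [← coeffSub_coeffAct g (Matrix.of fun r j : Fin 2 => pt (Sum.inr (if j = 0 then 0 else 1, r)))]
  have h : (Matrix.of fun r j : Fin 2 => ptActT ν g pt (Sum.inr (if j = 0 then 0 else 1, r))) =
      g.1 * Matrix.of fun r j : Fin 2 => pt (Sum.inr (if j = 0 then 0 else 1, r)) := by
    ext r j
    simp [ptActT, Matrix.mul_apply]
  rw [h]
  rfl

variable (ν)

/-- Specialization of `u, v` to the standard frame and of the remaining vector to zero. -/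
def evFrame : TRing ν →ₐ[ℂ] MvPolynomial (Σ i : ι, Fin (ν i + 1)) ℂ :=
  aeval (Sum.elim X fun v => if v = (0, 0) ∨ v = (1, 1) then 1 else 0)

variable {ν}

lemma evFrame_genSub (p : MvPolynomial (Σ i : ι, Fin (ν i + 1)) ℂ) :
    evFrame ν (genSub ν p) = p := by
  have h : (evFrame ν).comp (genSub ν) = AlgHom.id ℂ _ := by
    refine MvPolynomial.algHom_ext fun c => ?_
    have h1 : ∀ i, MvPolynomial.map (evFrame ν).toRingHom (genForm ν i) =
        ∑ j : Fin (ν i + 1), C (X ⟨i, j⟩) * X 0 ^ (ν i - (j : ℕ)) * X 1 ^ (j : ℕ) := by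
      intro i
      simp [genForm, genRow, evFrame]
    have h2 := congrArg (coeff (Finsupp.single 0 (ν c.1 - (c.2 : ℕ)) +
      Finsupp.single 1 (c.2 : ℕ))) (h1 c.1)
    rw [coeff_form_sum, coeff_map] at h2
    simpa [genSub] using h2
  exact DFunLike.congr_fun h p

end GenericSubstitution

section GordanExpansion

variable {ι : Type} (ν : ι → ℕ)

/-- Specialization of all vectors to zero. -/
def evBase : TRing ν →ₐ[ℂ] MvPolynomial (Σ i : ι, Fin (ν i + 1)) ℂ :=
  aeval (Sum.elim X 0)

/-- Specialization of the first vector to `(1, 0)` and of the others to zero. -/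
def evFirst : TRing ν →ₐ[ℂ] MvPolynomial (Σ i : ι, Fin (ν i + 1)) ℂ :=
  aeval (Sum.elim X fun v => if v = (0, 0) then 1 else 0)

/-- The span of the coefficients of the invariants with respect to the first vector. -/
def coeffSpan : Submodule ℂ (MvPolynomial (Σ i : ι, Fin (ν i + 1)) ℂ) :=
  Submodule.span ℂ {h | ∃ G ∈ InvT ν, ∃ a b : ℕ,
    h = evBase ν ((pdT ν (0, 0) ^ a) ((pdT ν (0, 1) ^ b) G))}

variable {ν}

lemma pdT_apply (v : Fin 3 × Fin 2) (p : TRing ν) : pdT ν v p = pderiv (Sum.inr v) p := rfl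

lemma pderiv_comm {σ R : Type} [CommRing R] (i j : σ) (p : MvPolynomial σ R) :
    pderiv i (pderiv j p) = pderiv j (pderiv i p) := by
  have h : ⁅(pderiv i : Derivation R (MvPolynomial σ R) (MvPolynomial σ R)),
      (pderiv j : Derivation R (MvPolynomial σ R) (MvPolynomial σ R))⁆ = 0 := by
    classical
    refine MvPolynomial.derivation_ext fun v => ?_
    rw [Derivation.commutator_apply, pderiv_X, pderiv_X]
    simp only [Pi.single_apply]
    split_ifs <;> simp
  have h' := DFunLike.congr_fun h p
  rw [Derivation.commutator_apply] at h'
  exact sub_eq_zero.1 h'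

lemma commute_pdT (v w : Fin 3 × Fin 2) : Commute (pdT ν v) (pdT ν w) :=
  LinearMap.ext fun p => pderiv_comm _ _ p

lemma evFirst_eq_evBase {F : TRing ν} (hF : polar ν 0 0 F = 0) : evFirst ν F = evBase ν F := by
  refine hom_congr_vars (f₁ := (evFirst ν).toRingHom) (f₂ := (evBase ν).toRingHom) ?_ ?_ rfl
  · ext; simp
  · intro v hv _
    rcases v with c | ⟨a, i⟩
    · simp [evFirst, evBase]
    · have ha : a ≠ 0 := by
        rintro rfl
        exact notMem_vars_of_polar_self hF i hv
      simp [evFirst, evBase, ha]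

lemma evFrame_eq_evFirst {F : TRing ν} (hF : polar ν 1 1 F = 0) : evFrame ν F = evFirst ν F := by
  refine hom_congr_vars (f₁ := (evFrame ν).toRingHom) (f₂ := (evFirst ν).toRingHom) ?_ ?_ rfl
  · ext; simp
  · intro v hv _
    rcases v with c | ⟨a, i⟩
    · simp [evFirst, evFrame]
    · have ha : a ≠ 1 := by
        rintro rfl
        exact notMem_vars_of_polar_self hF i hv
      simp [evFirst, evFrame, ha]

lemma evFirst_mem_coeffSpan {d : ℕ} {F : TRing ν} (hd : polar ν 0 0 F = d • F)
    (hF : ∀ a b, evBase ν ((pdT ν (0, 0) ^ a) ((pdT ν (0, 1) ^ b) F)) ∈ coeffSpan ν) :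
    evFirst ν F ∈ coeffSpan ν := by
  induction d generalizing F with
  | zero =>
    rw [zero_smul] at hd
    rw [evFirst_eq_evBase hd]
    simpa using hF 0 0
  | succ d ih =>
    have h1 : evFirst ν (pderiv (Sum.inr (0, 0)) F) ∈ coeffSpan ν := by
      refine ih (polar_self_pderiv hd 0) fun a b => ?_
      have h2 : (pdT ν (0, 0) ^ a) ((pdT ν (0, 1) ^ b) (pderiv (Sum.inr (0, 0)) F)) =
          (pdT ν (0, 0) ^ (a + 1)) ((pdT ν (0, 1) ^ b) F) := by
        have h3 := LinearMap.congr_fun ((commute_pdT (ν := ν) (0, 1) (0, 0)).pow_left b).eq F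
        rw [Module.End.mul_apply, Module.End.mul_apply, pdT_apply, pdT_apply] at h3
        rw [h3, pow_succ, Module.End.mul_apply, pdT_apply]
      rw [h2]
      exact hF _ _
    have h2 : evFirst ν (pderiv (Sum.inr (0, 0)) F) = (d + 1) • evFirst ν F := by
      rw [← map_nsmul, ← hd, polar_apply]
      simp [evFirst]
    rw [h2, ← Nat.cast_smul_eq_nsmul ℂ] at h1
    exact (Submodule.smul_mem_iff _ (by exact_mod_cast Nat.succ_ne_zero d)).1 h1

lemma evFrame_iterate_polar (i : ℕ) (F : TRing ν) :
    evFrame ν ((polar ν 1 0)^[i] F) = evFrame ν ((pdT ν (0, 1) ^ i) F) := by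
  induction i generalizing F with
  | zero => rfl
  | succ i ih =>
    have h1 : ∀ G, evFrame ν (polar ν 1 0 G) = evFrame ν (pderiv (Sum.inr (0, 1)) G) := by
      intro G
      rw [polar_apply]
      simp [evFrame]
    have h2 : ∀ k G, pderiv (Sum.inr (0, 1)) ((polar ν 1 0)^[k] G) =
        (polar ν 1 0)^[k] (pderiv (Sum.inr (0, 1)) G) := by
      intro k G
      induction k generalizing G with
      | zero => rfl
      | succ k ihk =>
        rw [Function.iterate_succ_apply, ihk, Function.iterate_succ_apply, polar_pderiv,
          if_neg (by decide), sub_zero]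
    rw [Function.iterate_succ_apply', h1, h2, ih, ← pdT_apply, ← Module.End.mul_apply, pow_succ]

lemma iterate_polar_bracket_mul (i : ℕ) (F : TRing ν) :
    (polar ν 1 0)^[i] ((X (Sum.inr (0, 0)) * X (Sum.inr (1, 1)) -
      X (Sum.inr (0, 1)) * X (Sum.inr (1, 0))) * F) = (X (Sum.inr (0, 0)) * X (Sum.inr (1, 1)) -
      X (Sum.inr (0, 1)) * X (Sum.inr (1, 0))) * (polar ν 1 0)^[i] F := by
  induction i generalizing F with
  | zero => rfl
  | succ i ih =>
    rw [Function.iterate_succ_apply, Function.iterate_succ_apply, ← ih]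
    congr 1
    simp only [Derivation.leibniz, map_sub, polar_X, smul_eq_mul]
    simp
    right
    ring

lemma polar_pdT_pow {c : ℕ} {G : TRing ν} (hc : polar ν 0 0 G = c • G)
    (hk : polar ν 1 1 G = 0) (i : ℕ) :
    ∃ d : ℕ, polar ν 0 0 ((pdT ν (0, 1) ^ i) G) = d • (pdT ν (0, 1) ^ i) G ∧
      polar ν 1 1 ((pdT ν (0, 1) ^ i) G) = 0 := by
  induction i with
  | zero => exact ⟨c, hc, hk⟩
  | succ i ih =>
    obtain ⟨d, hd, hd'⟩ := ih
    rw [pow_succ', Module.End.mul_apply, pdT_apply]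
    refine ⟨d - 1, polar_self_pderiv hd 1, ?_⟩
    rw [polar_pderiv, hd', map_zero, if_neg (by decide), sub_zero]

lemma evFrame_iterate_polar_mem_of_polar_eq_zero {c : ℕ} {G : TRing ν} (hG : G ∈ InvT ν)
    (hc : polar ν 0 0 G = c • G) (hk : polar ν 1 1 G = 0) (i : ℕ) :
    evFrame ν ((polar ν 1 0)^[i] G) ∈ coeffSpan ν := by
  rw [evFrame_iterate_polar]
  obtain ⟨d, hd, hd'⟩ := polar_pdT_pow hc hk i
  rw [evFrame_eq_evFirst hd']
  refine evFirst_mem_coeffSpan hd fun a b => Submodule.subset_span ⟨G, hG, a, b + i, ?_⟩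
  rw [pow_add, Module.End.mul_apply]

lemma smul_evFrame_iterate_polar {k c : ℕ} {G : TRing ν}
    (hc : polar ν 0 0 G = c • G) (hk : polar ν 1 1 G = k • G) (i : ℕ) :
    (k * c + k) • evFrame ν ((polar ν 1 0)^[i] G) =
      evFrame ν ((polar ν 1 0)^[i] (OmegaT ν 0 1 G)) +
        evFrame ν ((polar ν 1 0)^[i + 1] (polar ν 0 1 G)) := by
  have h1 := capelli G
  rw [hk, map_nsmul, hc, smul_smul, ← add_smul] at h1
  have h3 : evFrame ν (X (Sum.inr (0, 0)) * X (Sum.inr (1, 1)) -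
    X (Sum.inr (0, 1)) * X (Sum.inr (1, 0))) = 1 := by simp [evFrame]
  have h4 : (polar ν 1 0)^[i] ((k * c + k) • G) = (k * c + k) • (polar ν 1 0)^[i] G :=
    iterate_map_nsmul (polar ν 1 0) i G _
  rw [← map_nsmul, ← h4, h1, iterate_map_add, iterate_polar_bracket_mul, map_add, map_mul, h3,
    one_mul, Function.iterate_succ_apply]

lemma evFrame_iterate_polar_mem {k c : ℕ} {G : TRing ν} (hG : G ∈ InvT ν)
    (hc : polar ν 0 0 G = c • G) (hk : polar ν 1 1 G = k • G) (i : ℕ) :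
    evFrame ν ((polar ν 1 0)^[i] G) ∈ coeffSpan ν := by
  induction k generalizing c G i with
  | zero => exact evFrame_iterate_polar_mem_of_polar_eq_zero hG hc (by rw [hk, zero_smul]) i
  | succ k ih =>
    have h4 : evFrame ν ((polar ν 1 0)^[i] (OmegaT ν 0 1 G)) ∈ coeffSpan ν :=
      ih (OmegaT_mem_InvT hG 0 1) (polar_self_OmegaT_left (by decide) hc)
        (polar_self_OmegaT_right (by decide) hk) i
    have h5 : evFrame ν ((polar ν 1 0)^[i + 1] (polar ν 0 1 G)) ∈ coeffSpan ν := by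
      refine ih (c := c + 1) (polar_mem_InvT hG 0 1) ?_ ?_ (i + 1)
      · rw [polar_polar, hc]
        simp [add_smul]
      · rw [polar_polar, hk]
        simp [add_smul]
    have h6 := add_mem h4 h5
    rw [← smul_evFrame_iterate_polar hc hk, ← Nat.cast_smul_eq_nsmul ℂ] at h6
    exact (Submodule.smul_mem_iff _ (Nat.cast_ne_zero.2 (by positivity))).1 h6

lemma coeffSpan_eq_top : coeffSpan ν = ⊤ := by
  rw [eq_top_iff]
  intro m _
  induction m using MvPolynomial.induction_on' with
  | add p q hp hq => exact add_mem (hp trivial) (hq trivial)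
  | monomial s z =>
    obtain ⟨c, k, hc, hk⟩ := exists_polar_genSub_monomial s z
    have := evFrame_iterate_polar_mem (genSub_mem_InvT _) hc hk 0
    rwa [Function.iterate_zero_apply, evFrame_genSub] at this

end GordanExpansion

section Averaging

/-- Coefficientwise application of a linear functional. -/
def mapLin {Φ : Type} [CommRing Φ] [Algebra ℂ Φ] (l : Φ →ₗ[ℂ] ℂ)
    (F : MvPolynomial (Fin 2 × Fin 2) Φ) : MvPolynomial (Fin 2 × Fin 2) ℂ :=
  ∑ s ∈ F.support, monomial s (l (coeff s F))

variable {Φ : Type} [CommRing Φ] [Algebra ℂ Φ]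

lemma eval_mapLin (l : Φ →ₗ[ℂ] ℂ) (F : MvPolynomial (Fin 2 × Fin 2) Φ)
    (x : Fin 2 × Fin 2 → ℂ) :
    eval x (mapLin l F) = l (eval (fun v => algebraMap ℂ Φ (x v)) F) := by
  rw [mapLin, map_sum, eval_eq', map_sum]
  refine Finset.sum_congr rfl fun s _ => ?_
  rw [eval_monomial, Finsupp.prod_fintype _ _ (by simp)]
  simp only [← map_pow, ← map_prod]
  rw [mul_comm (coeff s F), ← Algebra.smul_def, map_smul, smul_eq_mul, mul_comm]

lemma haar_mapLin (l : Φ →ₗ[ℂ] ℂ) (F : MvPolynomial (Fin 2 × Fin 2) Φ) :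
    haar ℂ (mapLin l F) = l (haar Φ F) := by
  conv_rhs => rw [F.as_sum]
  rw [mapLin, map_sum, map_sum, map_sum]
  refine Finset.sum_congr rfl fun s _ => ?_
  rw [haar_monomial, haar_monomial, mul_comm (coeff s F), ← Algebra.smul_def, map_smul,
    smul_eq_mul, mul_comm, Algebra.algebraMap_self_apply]

/-- Averaging over `SL(2)` an identity that holds for every group element. -/
lemma sum_haar_eq_of_forall {κ : Type} (t : Finset κ) (l : κ → Φ →ₗ[ℂ] ℂ)
    (F : κ → MvPolynomial (Fin 2 × Fin 2) Φ) (c : ℂ)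
    (h : ∀ g : SL2, ∑ k ∈ t, l k (eval (fun v => algebraMap ℂ Φ (g.1 v.1 v.2)) (F k)) = c) :
    ∑ k ∈ t, l k (haar Φ (F k)) = c := by
  have h1 := haar_eq_zero_of_eval_eq_zero (∑ k ∈ t, mapLin (l k) (F k) - c • 1) (fun g => by
    simp only [map_sub, map_sum, eval_mapLin, smul_eval, map_one, mul_one, h g, sub_self])
  rw [map_sub, map_smul, haar_one, map_sum, smul_eq_mul, mul_one] at h1
  simp only [haar_mapLin] at h1
  exact sub_eq_zero.1 h1

end Averaging

section Symbols

/-- Symbols of differential operators: the first vector stands for multiplication and the two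
other ones for differentiation. -/
abbrev Symb : Type := MvPolynomial (Fin 3 × Fin 2) ℂ

variable {ι : Type} (ν : ι → ℕ)

/-- The elementary operators. -/
def symbOp (v : Fin 3 × Fin 2) : Module.End ℂ (TRing ν) :=
  if v.1 = 0 then LinearMap.mulLeft ℂ (X (Sum.inr v)) else pdT ν v

lemma symbOp_commute (v w : Fin 3 × Fin 2) : symbOp ν v * symbOp ν w = symbOp ν w * symbOp ν v := by
  have h : ∀ v w : Fin 3 × Fin 2, v.1 = 0 → w.1 ≠ 0 →
      Commute (LinearMap.mulLeft ℂ (X (Sum.inr v) : TRing ν)) (pdT ν w) := by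
    intro v w hv hw
    refine LinearMap.ext fun p => ?_
    have hvw : v ≠ w := fun h => hw (h ▸ hv)
    simp [pdT_apply, pderiv_X_of_ne (R := ℂ) (Sum.inr_injective.ne hvw)]
  rw [symbOp, symbOp]
  split_ifs with hv hw hw
  · refine LinearMap.ext fun p => ?_
    simp only [Module.End.mul_apply, LinearMap.mulLeft_apply]
    ring
  · exact h v w hv hw
  · exact (h w v hw hv).symm
  · exact commute_pdT v w

/-- The operator with a given symbol. -/
def symb : Symb →ₐ[ℂ] Module.End ℂ (TRing ν) :=
  letI : CommSemiring (Algebra.adjoin ℂ (Set.range (symbOp ν))) :=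
    { (inferInstance : Semiring (Algebra.adjoin ℂ (Set.range (symbOp ν)))) with
      mul_comm := by
        have := Algebra.isMulCommutative_adjoin ℂ (s := Set.range (symbOp ν)) (by
          rintro _ ⟨v, rfl⟩ _ ⟨w, rfl⟩
          exact symbOp_commute ν v w)
        exact this.is_comm.comm }
  (Algebra.adjoin ℂ (Set.range (symbOp ν))).val.comp
    (aeval fun v => (⟨symbOp ν v, Algebra.subset_adjoin ⟨v, rfl⟩⟩ :
      Algebra.adjoin ℂ (Set.range (symbOp ν))))

lemma symb_X (v : Fin 3 × Fin 2) : symb ν (X v) = symbOp ν v := by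
  simp [symb]

lemma symb_X_zero (i : Fin 2) (p : TRing ν) :
    symb ν (X (0, i)) p = X (Sum.inr (0, i)) * p := by
  rw [symb_X, symbOp, if_pos rfl, LinearMap.mulLeft_apply]

lemma symb_X_of_ne {a : Fin 3} (ha : a ≠ 0) (i : Fin 2) : symb ν (X (a, i)) = pdT ν (a, i) := by
  rw [symb_X, symbOp, if_neg ha]

/-- The bracket of a vector with the dual vector `J a`. -/
def covec (a : Fin 3) (i : Fin 2) : Symb :=
  if a = 0 then X (0, i) else if i = 0 then -X (a, 1) else X (a, 0)

/-- The generic action on symbols. -/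
def genAct : Symb →ₐ[ℂ] MvPolynomial (Fin 2 × Fin 2) Symb :=
  aeval fun v => if v.1 = 0 then rowForm v.2 (covec 0) else
    if v.2 = 0 then rowForm 1 (covec v.1) else -rowForm 0 (covec v.1)

/-- The brackets of the three vectors. -/
def brackets : Subalgebra ℂ Symb :=
  Algebra.adjoin ℂ {X (1, 0) * X (2, 1) - X (1, 1) * X (2, 0),
    X (0, 0) * X (1, 0) + X (0, 1) * X (1, 1), X (0, 0) * X (2, 0) + X (0, 1) * X (2, 1)}

lemma covec_bracket_mem (a b : Fin 3) :
    covec a 0 * covec b 1 - covec a 1 * covec b 0 ∈ brackets := by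
  have h1 : X (1, 0) * X (2, 1) - X (1, 1) * X (2, 0) ∈ brackets :=
    Algebra.subset_adjoin (by simp)
  have h2 : X (0, 0) * X (1, 0) + X (0, 1) * X (1, 1) ∈ brackets :=
    Algebra.subset_adjoin (by simp)
  have h3 : X (0, 0) * X (2, 0) + X (0, 1) * X (2, 1) ∈ brackets :=
    Algebra.subset_adjoin (by simp)
  have h4 := neg_mem h1
  have h5 := neg_mem h2
  have h6 := neg_mem h3
  have h0 := zero_mem brackets
  fin_cases a <;> fin_cases b <;> simp [covec]
  · ring_nf; exact h0
  · convert h2 using 1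
  · convert h3 using 1
  · convert h5 using 1; ring
  · ring_nf; exact h0
  · convert h1 using 1; ring
  · convert h6 using 1; ring
  · convert h4 using 1; ring
  · ring_nf; exact h0

lemma genAct_monomial (s : Fin 3 × Fin 2 →₀ ℕ) (z : ℂ) :
    ∃ (y : ℂ) (l₀ l₁ : List (Fin 2 → Symb)), (∀ c ∈ l₀, c ∈ Set.range covec) ∧
      (∀ c ∈ l₁, c ∈ Set.range covec) ∧ genAct (monomial s z) =
        C (C y) * ((l₀.map (rowForm 0)).prod * (l₁.map (rowForm 1)).prod) := by
  refine MvPolynomial.induction_on_monomial (motive := fun p => ∃ (y : ℂ)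
    (l₀ l₁ : List (Fin 2 → Symb)), (∀ c ∈ l₀, c ∈ Set.range covec) ∧
      (∀ c ∈ l₁, c ∈ Set.range covec) ∧ genAct p =
        C (C y) * ((l₀.map (rowForm 0)).prod * (l₁.map (rowForm 1)).prod))
    (fun y => ⟨y, [], [], by simp, by simp, ?_⟩) (fun p v hp => ?_) s z
  · simp [MvPolynomial.algHom_C]
  · obtain ⟨y, l₀, l₁, h₀, h₁, h⟩ := hp
    have hv : genAct (X v) = if v.1 = 0 then rowForm v.2 (covec 0) else
      if v.2 = 0 then rowForm 1 (covec v.1) else -rowForm 0 (covec v.1) := by rw [genAct, aeval_X]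
    have h₀' : ∀ a, ∀ c ∈ covec a :: l₀, c ∈ Set.range covec := by
      intro a c hc
      rcases List.mem_cons.1 hc with rfl | hc
      exacts [⟨a, rfl⟩, h₀ c hc]
    have h₁' : ∀ a, ∀ c ∈ covec a :: l₁, c ∈ Set.range covec := by
      intro a c hc
      rcases List.mem_cons.1 hc with rfl | hc
      exacts [⟨a, rfl⟩, h₁ c hc]
    obtain ⟨a, i⟩ := v
    rw [map_mul, h, hv]
    by_cases ha : a = 0
    · rw [if_pos ha]
      by_cases hi : i = 0
      · refine ⟨y, _, _, h₀' 0, h₁, ?_⟩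
        simp only [hi, List.map_cons, List.prod_cons]
        ring
      · obtain rfl : i = 1 := by omega
        refine ⟨y, _, _, h₀, h₁' 0, ?_⟩
        simp only [List.map_cons, List.prod_cons]
        ring
    · rw [if_neg ha]
      by_cases hi : i = 0
      · refine ⟨y, _, _, h₀, h₁' a, ?_⟩
        simp only [hi, if_true, List.map_cons, List.prod_cons]
        ring
      · refine ⟨-y, _, _, h₀' a, h₁, ?_⟩
        simp only [hi, if_false, List.map_cons, List.prod_cons, map_neg]
        ring

lemma haar_genAct_mem (φ : Symb) : haar Symb (genAct φ) ∈ brackets := by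
  induction φ using MvPolynomial.induction_on' with
  | add p q hp hq => rw [map_add, map_add]; exact add_mem hp hq
  | monomial s z =>
    obtain ⟨y, l₀, l₁, h₀, h₁, h⟩ := genAct_monomial s z
    rw [h, ← smul_eq_C_mul, map_smul, smul_eq_mul]
    refine mul_mem (Subalgebra.algebraMap_mem _ y)
      (haar_prod_rowForm_mem brackets (Set.range covec) ?_ l₀ l₁ h₀ h₁)
    rintro _ ⟨a, rfl⟩ _ ⟨b, rfl⟩
    exact covec_bracket_mem a b

/-- The action of a group element on symbols. -/
def symbAct (g : SL2) (φ : Symb) : Symb :=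
  eval (fun v => algebraMap ℂ Symb (g.1 v.1 v.2)) (genAct φ)

lemma actT_symb (g : SL2) (φ : Symb) (p : TRing ν) :
    actT ν g (symb ν φ p) = symb ν (symbAct g φ) (actT ν g p) := by
  have hd : C (g.1 0 0) * C (g.1 1 1) - C (g.1 0 1) * C (g.1 1 0) = (1 : TRing ν) := by
    rw [← C_mul, ← C_mul, ← C_sub, ← Matrix.det_fin_two, g.2, C_1]
  have hX : ∀ v p, actT ν g (symb ν (X v) p) = symb ν (symbAct g (X v)) (actT ν g p) := by
    rintro ⟨a, i⟩ p
    by_cases ha : a = 0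
    · subst ha
      rw [symb_X_zero, map_mul, symbAct, genAct, aeval_X, if_pos rfl]
      simp only [actT, aeval_X, Sum.elim_inr, Fin.sum_univ_two, rowForm, covec, map_add, map_mul,
        eval_C, eval_X, LinearMap.add_apply, Module.End.mul_apply, if_true, symb_X_zero,
        AlgHom.commutes, Module.algebraMap_end_apply, smul_eq_C_mul]
      ring
    · rw [symb_X_of_ne ν ha, symbAct, genAct, aeval_X, if_neg ha]
      have h0 : ∀ j, symb ν (X (a, j)) (actT ν g p) =
        ∑ k : Fin 2, C (g.1 k j) * actT ν g (pderiv (Sum.inr (a, k)) p) := by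
        intro j
        rw [symb_X_of_ne ν ha, pdT_apply, pderiv_actT]
      by_cases hi : i = 0
      · subst hi
        simp only [rowForm, covec, ha, if_true, if_false, one_ne_zero, map_add, map_mul, eval_C,
          eval_X, LinearMap.add_apply, Module.End.mul_apply, AlgHom.commutes,
          Module.algebraMap_end_apply, smul_eq_C_mul, map_neg, LinearMap.neg_apply, pdT_apply,
          h0, Fin.sum_univ_two, mul_comm (X _) (algebraMap _ _ _),
          mul_comm (-X _) (algebraMap _ _ _)]
        linear_combination (-actT ν g (pderiv (Sum.inr (a, 0)) p)) * hd
      · obtain rfl : i = 1 := by omega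
        simp only [rowForm, covec, ha, if_true, if_false, one_ne_zero, map_add, map_mul, eval_C,
          eval_X, LinearMap.add_apply, Module.End.mul_apply, AlgHom.commutes,
          Module.algebraMap_end_apply, smul_eq_C_mul, map_neg, LinearMap.neg_apply, pdT_apply,
          h0, Fin.sum_univ_two, mul_comm (X _) (algebraMap _ _ _),
          mul_comm (-X _) (algebraMap _ _ _)]
        linear_combination (-actT ν g (pderiv (Sum.inr (a, 1)) p)) * hd
  induction φ using MvPolynomial.induction_on generalizing p with
  | C r =>
    have : symbAct g (C r) = C r := by
      simp [symbAct, MvPolynomial.algHom_C]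
    rw [this, ← MvPolynomial.algebraMap_eq, AlgHom.commutes]
    simp
  | add φ ψ hφ hψ =>
    simp only [symbAct, map_add, LinearMap.add_apply] at hφ hψ ⊢
    rw [hφ, hψ]
  | mul_X φ v hφ =>
    have : symbAct g (φ * X v) = symbAct g φ * symbAct g (X v) := by simp only [symbAct, map_mul]
    rw [this, map_mul, map_mul, Module.End.mul_apply, Module.End.mul_apply, hφ, hX]

end Symbols

section Spanning

variable {ι : Type} {ν : ι → ℕ}

/-- The derivatives of covariants with respect to the variables. -/
def pdV (ν : ι → ℕ) (i : Fin 2) : Module.End ℂ (CoordRing ν) :=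
  (pderiv (Sum.inr i)).toLinearMap

/-- The value of a covariant at the zero vector. -/
def evC (ν : ι → ℕ) : CoordRing ν →ₐ[ℂ] MvPolynomial (Σ i : ι, Fin (ν i + 1)) ℂ :=
  aeval (Sum.elim X 0)

lemma pdV_apply (i : Fin 2) (p : CoordRing ν) : pdV ν i p = pderiv (Sum.inr i) p := rfl

lemma evBase_eq (p : TRing ν) : evBase ν p = evC ν (evZero ν p) := by
  have h : evBase ν = (evC ν).comp (evZero ν) := by
    refine MvPolynomial.algHom_ext fun v => ?_
    rcases v with c | ⟨a, i⟩
    · simp [evBase, evC, evZero]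
    · by_cases ha : a = 0 <;> simp [evBase, evC, evZero, ha]
  rw [h]
  rfl

lemma evZero_pdT (i : Fin 2) (p : TRing ν) :
    evZero ν (pdT ν (0, i) p) = pdV ν i (evZero ν p) := by
  classical
  simp only [pdT_apply, pdV_apply]
  induction p using MvPolynomial.induction_on with
  | C r => simp [MvPolynomial.algHom_C, MvPolynomial.algebraMap_eq]
  | add p q hp hq => simp only [map_add, hp, hq]
  | mul_X p v hp =>
    rw [Derivation.leibniz, map_add, smul_eq_mul, smul_eq_mul, map_mul, map_mul, hp, map_mul,
      Derivation.leibniz, smul_eq_mul, smul_eq_mul]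
    congr 2
    rcases v with c | ⟨a, j⟩
    · simp [evZero, pderiv_X]
    · by_cases ha : a = 0
      · by_cases hj : j = i <;> simp [evZero, pderiv_X, ha, hj]
      · simp [evZero, pderiv_X, ha]

lemma evZero_pdT_pow (i : Fin 2) (k : ℕ) (p : TRing ν) :
    evZero ν ((pdT ν (0, i) ^ k) p) = (pdV ν i ^ k) (evZero ν p) := by
  induction k with
  | zero => rfl
  | succ k ih =>
    rw [pow_succ', pow_succ', Module.End.mul_apply, Module.End.mul_apply, evZero_pdT, ih]

/-- Every polynomial in the coefficients is a combination of coefficients of monomials in a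
generating set of covariants. -/
lemma span_evC_monomials {p : ℕ} (f : Fin p → CoordRing ν)
    (hf : Covariants ν = Algebra.adjoin ℂ (Set.range f)) :
    Submodule.span ℂ {h | ∃ (α : Fin p → ℕ) (a b : ℕ),
      h = evC ν ((pdV ν 0 ^ a) ((pdV ν 1 ^ b) (∏ i, f i ^ α i)))} = ⊤ := by
  rw [eq_top_iff, ← coeffSpan_eq_top, coeffSpan, Submodule.span_le]
  rintro _ ⟨G, hG, a, b, rfl⟩
  have hU := evZero_mem_Covariants hG
  rw [hf, Algebra.adjoin_range_eq_range_aeval] at hU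
  obtain ⟨Q, hQ⟩ := hU
  rw [evBase_eq, evZero_pdT_pow, evZero_pdT_pow, ← hQ]
  have hQ' : (aeval f : MvPolynomial (Fin p) ℂ →ₐ[ℂ] CoordRing ν).toRingHom Q =
      ∑ s ∈ Q.support, coeff s Q • ∏ i, f i ^ s i := by
    change aeval f Q = _
    rw [aeval_def, eval₂_eq']
    simp only [Algebra.smul_def]
  rw [hQ']
  simp only [map_sum, map_smul]
  exact sum_mem fun s _ => Submodule.smul_mem _ _ (Submodule.subset_span ⟨s, a, b, rfl⟩)

lemma evZero_embT {a : Fin 3} (ha : a ≠ 0) (p : CoordRing ν) :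
    evZero ν (embT ν a p) = rename Sum.inl (evC ν p) := by
  have h : (evZero ν).comp (embT ν a) = (rename Sum.inl).comp (evC ν) := by
    refine MvPolynomial.algHom_ext fun v => ?_
    rcases v with c | i <;> simp [evZero, evC, embT, ha]
  exact DFunLike.congr_fun h p

lemma injective_slot (a : Fin 3) : Function.Injective
    (Sum.map id (fun i => (a, i)) : Var ν → TVar ν) :=
  Function.Injective.sumMap Function.injective_id fun _ _ h => (Prod.ext_iff.1 h).2

lemma pderiv_embT_self (a : Fin 3) (i : Fin 2) (p : CoordRing ν) :
    pderiv (Sum.inr (a, i)) (embT ν a p) = embT ν a (pderiv (Sum.inr i) p) :=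
  pderiv_rename (injective_slot a) (Sum.inr i) p

lemma pderiv_embT_of_ne {a b : Fin 3} (hab : a ≠ b) (i : Fin 2) (p : CoordRing ν) :
    pderiv (Sum.inr (a, i)) (embT ν b p) = 0 := by
  classical
  refine pderiv_eq_zero_of_notMem_vars fun h => ?_
  obtain ⟨v, -, hv⟩ := Finset.mem_image.1 (vars_rename _ _ h)
  rcases v with c | j
  · simp at hv
  · simp only [Sum.map_inr, Sum.inr.injEq, Prod.mk.injEq] at hv
    exact hab hv.1.symm

lemma pdT_one_pow (i : Fin 2) (k : ℕ) (U W : CoordRing ν) :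
    (pdT ν (1, i) ^ k) (embT ν 1 U * embT ν 2 W) = embT ν 1 ((pdV ν i ^ k) U) * embT ν 2 W := by
  induction k with
  | zero => rfl
  | succ k ih =>
    rw [pow_succ', pow_succ', Module.End.mul_apply, Module.End.mul_apply, ih, pdT_apply,
      Derivation.leibniz, pderiv_embT_self, pderiv_embT_of_ne (by decide), pdV_apply]
    simp only [smul_eq_mul]
    ring

lemma pdT_two_pow (i : Fin 2) (k : ℕ) (U W : CoordRing ν) :
    (pdT ν (2, i) ^ k) (embT ν 1 U * embT ν 2 W) = embT ν 1 U * embT ν 2 ((pdV ν i ^ k) W) := by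
  induction k with
  | zero => rfl
  | succ k ih =>
    rw [pow_succ', pow_succ', Module.End.mul_apply, Module.End.mul_apply, ih, pdT_apply,
      Derivation.leibniz, pderiv_embT_self, pderiv_embT_of_ne (by decide), pdV_apply]
    simp only [smul_eq_mul]
    ring

lemma symb_X_zero_pow (i : Fin 2) (k : ℕ) (p : TRing ν) :
    (symb ν (X (0, i)) ^ k) p = X (Sum.inr (0, i)) ^ k * p := by
  induction k with
  | zero => simp
  | succ k ih => rw [pow_succ', Module.End.mul_apply, ih, symb_X_zero]; ring

lemma evZero_symb_monomial (k l a b c d : ℕ) (U W : CoordRing ν) :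
    evZero ν (symb ν (X (0, 0) ^ k * X (0, 1) ^ l * (X (1, 0) ^ a * X (1, 1) ^ b) *
        (X (2, 0) ^ c * X (2, 1) ^ d)) (embT ν 1 U * embT ν 2 W)) =
      X (Sum.inr 0) ^ k * X (Sum.inr 1) ^ l *
        rename Sum.inl (evC ν ((pdV ν 0 ^ a) ((pdV ν 1 ^ b) U))) *
        rename Sum.inl (evC ν ((pdV ν 0 ^ c) ((pdV ν 1 ^ d) W))) := by
  simp only [map_mul, map_pow, Module.End.mul_apply, symb_X_zero_pow]
  rw [symb_X_of_ne ν (by decide), symb_X_of_ne ν (by decide), symb_X_of_ne ν (by decide),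
    symb_X_of_ne ν (by decide), pdT_two_pow, pdT_two_pow, pdT_one_pow, pdT_one_pow]
  rw [map_mul, evZero_embT (by decide), evZero_embT (by decide)]
  simp only [evZero, aeval_X, Sum.elim_inr, if_true]
  ring

section Joint

variable {ι₁ ι₂ : Type} (n : ι₁ → ℕ) (m : ι₂ → ℕ)

/-- The embedding of the coefficients of the first space. -/
abbrev inclL (c : Σ i : ι₁, Fin (n i + 1)) : Σ k : ι₁ ⊕ ι₂, Fin (Sum.elim n m k + 1) :=
  ⟨Sum.inl c.1, c.2⟩

/-- The embedding of the coefficients of the second space. -/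
abbrev inclR (c : Σ i : ι₂, Fin (m i + 1)) : Σ k : ι₁ ⊕ ι₂, Fin (Sum.elim n m k + 1) :=
  ⟨Sum.inr c.1, c.2⟩

lemma injective_inclL :
    Function.Injective (Sum.map (inclL n m) id : Var n → Var (Sum.elim n m)) := by
  refine Function.Injective.sumMap ?_ Function.injective_id
  rintro ⟨i, k⟩ ⟨j, l⟩ h
  cases h
  rfl

lemma injective_inclR :
    Function.Injective (Sum.map (inclR n m) id : Var m → Var (Sum.elim n m)) := by
  refine Function.Injective.sumMap ?_ Function.injective_id
  rintro ⟨i, k⟩ ⟨j, l⟩ h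
  cases h
  rfl

lemma pderiv_embL (i : Fin 2) (p : CoordRing n) :
    pderiv (Sum.inr i) (embL n m p) = embL n m (pderiv (Sum.inr i) p) :=
  pderiv_rename (injective_inclL n m) (Sum.inr i) p

lemma pderiv_embR (i : Fin 2) (p : CoordRing m) :
    pderiv (Sum.inr i) (embR n m p) = embR n m (pderiv (Sum.inr i) p) :=
  pderiv_rename (injective_inclR n m) (Sum.inr i) p

lemma pdV_pow_embL (i : Fin 2) (k : ℕ) (p : CoordRing n) :
    (pdV _ i ^ k) (embL n m p) = embL n m ((pdV n i ^ k) p) := by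
  induction k with
  | zero => rfl
  | succ k ih =>
    rw [pow_succ', pow_succ', Module.End.mul_apply, Module.End.mul_apply, ih]
    exact pderiv_embL n m i _

lemma pdV_pow_embR (i : Fin 2) (k : ℕ) (p : CoordRing m) :
    (pdV _ i ^ k) (embR n m p) = embR n m ((pdV m i ^ k) p) := by
  induction k with
  | zero => rfl
  | succ k ih =>
    rw [pow_succ', pow_succ', Module.End.mul_apply, Module.End.mul_apply, ih]
    exact pderiv_embR n m i _

lemma evC_embL (p : CoordRing n) : evC _ (embL n m p) = rename (inclL n m) (evC n p) := by
  have h : (evC _).comp (embL n m) = (rename (inclL n m)).comp (evC n) := by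
    refine MvPolynomial.algHom_ext fun v => ?_
    rcases v with c | i <;> simp [evC, embL]
  exact DFunLike.congr_fun h p

lemma evC_embR (p : CoordRing m) : evC _ (embR n m p) = rename (inclR n m) (evC m p) := by
  have h : (evC _).comp (embR n m) = (rename (inclR n m)).comp (evC m) := by
    refine MvPolynomial.algHom_ext fun v => ?_
    rcases v with c | i <;> simp [evC, embR]
  exact DFunLike.congr_fun h p

/-- The product of two covariants in the second and third vectors. -/
abbrev tens (U : CoordRing n) (W : CoordRing m) : TRing (Sum.elim n m) :=
  embT _ 1 (embL n m U) * embT _ 2 (embR n m W)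

lemma exists_monomial_eq (s : Var (Sum.elim n m) →₀ ℕ) (z : ℂ) :
    ∃ (k l : ℕ) (h₁ : MvPolynomial (Σ i : ι₁, Fin (n i + 1)) ℂ)
      (h₂ : MvPolynomial (Σ i : ι₂, Fin (m i + 1)) ℂ),
      (monomial s z : CoordRing (Sum.elim n m)) = X (Sum.inr 0) ^ k * X (Sum.inr 1) ^ l *
        rename Sum.inl (rename (inclL n m) h₁) * rename Sum.inl (rename (inclR n m) h₂) := by
  refine MvPolynomial.induction_on_monomial (motive := fun P =>
    ∃ (k l : ℕ) (h₁ : MvPolynomial (Σ i : ι₁, Fin (n i + 1)) ℂ)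
      (h₂ : MvPolynomial (Σ i : ι₂, Fin (m i + 1)) ℂ),
      P = X (Sum.inr 0) ^ k * X (Sum.inr 1) ^ l *
        rename Sum.inl (rename (inclL n m) h₁) * rename Sum.inl (rename (inclR n m) h₂))
    (fun y => ⟨0, 0, C y, 1, by simp⟩) (fun P v hP => ?_) s z
  obtain ⟨k, l, h₁, h₂, rfl⟩ := hP
  rcases v with ⟨i | i, j⟩ | i
  · refine ⟨k, l, h₁ * X ⟨i, j⟩, h₂, ?_⟩
    simp only [map_mul, rename_X]
    ring
  · refine ⟨k, l, h₁, h₂ * X ⟨i, j⟩, ?_⟩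
    simp only [map_mul, rename_X]
    ring
  · by_cases hi : i = 0
    · exact ⟨k + 1, l, h₁, h₂, by rw [hi]; ring⟩
    · obtain rfl : i = 1 := by omega
      exact ⟨k, l + 1, h₁, h₂, by ring⟩

lemma span_symb_eq_top {p q : ℕ} (f : Fin p → CoordRing n) (g : Fin q → CoordRing m)
    (hf : Covariants n = Algebra.adjoin ℂ (Set.range f))
    (hg : Covariants m = Algebra.adjoin ℂ (Set.range g)) :
    Submodule.span ℂ {h | ∃ (α : Fin p → ℕ) (β : Fin q → ℕ) (φ : Symb),
      h = evZero _ (symb _ φ (tens n m (∏ i, f i ^ α i) (∏ j, g j ^ β j)))} = ⊤ := by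
  set N := Submodule.span ℂ {h | ∃ (α : Fin p → ℕ) (β : Fin q → ℕ) (φ : Symb),
      h = evZero _ (symb _ φ (tens n m (∏ i, f i ^ α i) (∏ j, g j ^ β j)))} with hN
  have key : ∀ (k l : ℕ) (h₁ : MvPolynomial (Σ i : ι₁, Fin (n i + 1)) ℂ)
      (h₂ : MvPolynomial (Σ i : ι₂, Fin (m i + 1)) ℂ), X (Sum.inr 0) ^ k * X (Sum.inr 1) ^ l *
        rename Sum.inl (rename (inclL n m) h₁) * rename Sum.inl (rename (inclR n m) h₂) ∈ N := by
    intro k l h₁ h₂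
    have m₁ : h₁ ∈ Submodule.span ℂ {h | ∃ (α : Fin p → ℕ) (a b : ℕ),
      h = evC n ((pdV n 0 ^ a) ((pdV n 1 ^ b) (∏ i, f i ^ α i)))} := by
      rw [span_evC_monomials f hf]; trivial
    have m₂ : h₂ ∈ Submodule.span ℂ {h | ∃ (α : Fin q → ℕ) (a b : ℕ),
      h = evC m ((pdV m 0 ^ a) ((pdV m 1 ^ b) (∏ i, g i ^ α i)))} := by
      rw [span_evC_monomials g hg]; trivial
    induction m₁ using Submodule.span_induction with
    | zero => simp
    | add x y _ _ hx hy =>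
      simp only [map_add, mul_add, add_mul]
      exact add_mem hx hy
    | smul r x _ hx =>
      simp only [map_smul, mul_smul_comm, smul_mul_assoc]
      exact N.smul_mem r hx
    | mem x hx =>
      obtain ⟨α, a, b, rfl⟩ := hx
      induction m₂ using Submodule.span_induction with
      | zero => simp
      | add x y _ _ hx hy =>
        simp only [map_add, mul_add]
        exact add_mem hx hy
      | smul r x _ hx =>
        simp only [map_smul, mul_smul_comm]
        exact N.smul_mem r hx
      | mem x hx =>
        obtain ⟨β, c, d, rfl⟩ := hx
        refine Submodule.subset_span ⟨α, β, X (0, 0) ^ k * X (0, 1) ^ l *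
          (X (1, 0) ^ a * X (1, 1) ^ b) * (X (2, 0) ^ c * X (2, 1) ^ d), ?_⟩
        rw [evZero_symb_monomial, pdV_pow_embL, pdV_pow_embL, pdV_pow_embR, pdV_pow_embR,
          evC_embL, evC_embR]
  rw [eq_top_iff]
  intro P _
  induction P using MvPolynomial.induction_on' with
  | add p q hp hq => exact add_mem (hp trivial) (hq trivial)
  | monomial s z =>
    obtain ⟨k, l, h₁, h₂, h⟩ := exists_monomial_eq n m s z
    rw [h]
    exact key k l h₁ h₂

variable {n m}

lemma tens_mem_InvT {U : CoordRing n} {W : CoordRing m} (hU : U ∈ Covariants n)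
    (hW : W ∈ Covariants m) : tens n m U W ∈ InvT (Sum.elim n m) :=
  mul_mem (embT_mem_InvT (embL_mem_Covariants n m hU) 1)
    (embT_mem_InvT (embR_mem_Covariants n m hW) 2)

end Joint

lemma sum_evZero_symbAct {κ : Type} (t : Finset κ) (φ : κ → Symb) (S : κ → TRing ν)
    (hS : ∀ k, S k ∈ InvT ν) (h : ∑ k ∈ t, evZero ν (symb ν (φ k) (S k)) ∈ Covariants ν) (g : SL2) :
    ∑ k ∈ t, evZero ν (symb ν (symbAct g (φ k)) (S k)) =
      ∑ k ∈ t, evZero ν (symb ν (φ k) (S k)) := by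
  refine MvPolynomial.funext fun pt => ?_
  have h₁ := h g pt
  rw [← map_sum, eval_evZero, eval_evZero, ← ptActT_liftPt, ← eval_actT, map_sum] at h₁
  rw [← map_sum, ← map_sum, eval_evZero, eval_evZero, ← h₁]
  simp only [actT_symb, mem_InvT.1 (hS _)]

/-- The averaged symbols represent the same covariant. -/
lemma sum_evZero_haar {κ : Type} (t : Finset κ) (φ : κ → Symb) (S : κ → TRing ν)
    (hS : ∀ k, S k ∈ InvT ν) (h : ∑ k ∈ t, evZero ν (symb ν (φ k) (S k)) ∈ Covariants ν) :
    ∑ k ∈ t, evZero ν (symb ν (haar Symb (genAct (φ k))) (S k)) =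
      ∑ k ∈ t, evZero ν (symb ν (φ k) (S k)) := by
  ext s
  have := sum_haar_eq_of_forall t
    (fun k => (lcoeff ℂ s).comp ((evZero ν).toLinearMap.comp
      ((LinearMap.applyₗ (S k)).comp (symb ν).toLinearMap)))
    (fun k => genAct (φ k)) (coeff s (∑ k ∈ t, evZero ν (symb ν (φ k) (S k)))) (fun g => by
      rw [← sum_evZero_symbAct t φ S hS h g, coeff_sum]
      rfl)
  rw [← this, coeff_sum]
  rfl

end Spanning

section Transvectants

variable {ι : Type} {ν : ι → ℕ}

lemma pow_apply_eigen_of_lower (D : Derivation ℂ (TRing ν) (TRing ν)) (T : Module.End ℂ (TRing ν))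
    (hT : ∀ p, D (T p) = T (D p) - T p) {p : TRing ν} {z : ℂ} (hp : D p = z • p) (k : ℕ) :
    D ((T ^ k) p) = (z - k) • (T ^ k) p := by
  induction k with
  | zero => simpa using hp
  | succ k ih =>
    rw [pow_succ', Module.End.mul_apply, hT, ih, map_smul, Nat.cast_succ, ← sub_sub,
      sub_smul _ (1 : ℂ), one_smul]

lemma pow_apply_eigen_of_comm (D : Derivation ℂ (TRing ν) (TRing ν)) (T : Module.End ℂ (TRing ν))
    (hT : ∀ p, D (T p) = T (D p)) {p : TRing ν} {z : ℂ} (hp : D p = z • p) (k : ℕ) :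
    D ((T ^ k) p) = z • (T ^ k) p := by
  induction k with
  | zero => simpa using hp
  | succ k ih => rw [pow_succ', Module.End.mul_apply, hT, ih, map_smul]

lemma polar_self_SigmaT {a : Fin 3} (ha : a ≠ 0) (p : TRing ν) :
    polar ν a a (SigmaT ν a p) = SigmaT ν a (polar ν a a p) - SigmaT ν a p := by
  rw [SigmaT_apply, SigmaT_apply, polar_polar, if_neg ha, if_pos rfl, add_zero]

lemma polar_self_SigmaT_of_ne {a b : Fin 3} (ha : a ≠ 0) (hab : a ≠ b) (p : TRing ν) :
    polar ν a a (SigmaT ν b p) = SigmaT ν b (polar ν a a p) := by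
  rw [SigmaT_apply, SigmaT_apply, polar_polar, if_neg ha, if_neg hab, add_zero, sub_zero]

lemma polar_one_OmegaT (p : TRing ν) :
    polar ν 1 1 (OmegaT ν 1 2 p) = OmegaT ν 1 2 (polar ν 1 1 p) - OmegaT ν 1 2 p := by
  simp [OmegaT_apply, polar_pderiv]
  ring

lemma polar_two_OmegaT (p : TRing ν) :
    polar ν 2 2 (OmegaT ν 1 2 p) = OmegaT ν 1 2 (polar ν 2 2 p) - OmegaT ν 1 2 p := by
  simp [OmegaT_apply, polar_pderiv]
  ring

lemma evZero_polar_self {a : Fin 3} (ha : a ≠ 0) (p : TRing ν) :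
    evZero ν (polar ν a a p) = 0 := by
  simp [polar_apply, evZero, ha]

lemma evZero_eq_zero_of_eigen {a : Fin 3} (ha : a ≠ 0) {p : TRing ν} {z : ℂ} (hz : z ≠ 0)
    (hp : polar ν a a p = z • p) : evZero ν p = 0 := by
  have h := evZero_polar_self ha p
  rw [hp, map_smul] at h
  exact (smul_eq_zero.1 h).resolve_left hz

lemma evZero_eq_collapseT {p : TRing ν} (h₁ : polar ν 1 1 p = 0) (h₂ : polar ν 2 2 p = 0) :
    evZero ν p = collapseT ν p := by
  refine hom_congr_vars (f₁ := (evZero ν).toRingHom) (f₂ := (collapseT ν).toRingHom) ?_ ?_ rfl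
  · ext; simp
  · intro v hv _
    rcases v with c | ⟨a, i⟩
    · simp [evZero, collapseT]
    · fin_cases a
      · simp [evZero, collapseT]
      · exact (notMem_vars_of_polar_self h₁ i hv).elim
      · exact (notMem_vars_of_polar_self h₂ i hv).elim

/-- The value of a product of polarizations and Cayley operators is zero or a transvectant. -/
lemma evZero_OmegaT_SigmaT {U W : CoordRing ν} {u w : ℕ}
    (hU : polar ν 1 1 (embT ν 1 U * embT ν 2 W) = (u : ℂ) • (embT ν 1 U * embT ν 2 W))
    (hW : polar ν 2 2 (embT ν 1 U * embT ν 2 W) = (w : ℂ) • (embT ν 1 U * embT ν 2 W))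
    (r i j : ℕ) :
    evZero ν ((OmegaT ν 1 2 ^ r) ((SigmaT ν 1 ^ i) ((SigmaT ν 2 ^ j)
      (embT ν 1 U * embT ν 2 W)))) =
      if r + i = u ∧ r + j = w then transvect ν u w r U W else 0 := by
  set Q := (OmegaT ν 1 2 ^ r) ((SigmaT ν 1 ^ i) ((SigmaT ν 2 ^ j) (embT ν 1 U * embT ν 2 W)))
    with hQ
  have h₁ : polar ν 1 1 Q = ((u : ℂ) - i - r) • Q :=
    pow_apply_eigen_of_lower _ _ polar_one_OmegaT (pow_apply_eigen_of_lower _ _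
      (polar_self_SigmaT (by decide)) (pow_apply_eigen_of_comm _ _
        (polar_self_SigmaT_of_ne (by decide) (by decide)) hU j) i) r
  have h₂ : polar ν 2 2 Q = ((w : ℂ) - j - r) • Q :=
    pow_apply_eigen_of_lower _ _ polar_two_OmegaT (pow_apply_eigen_of_comm _ _
      (polar_self_SigmaT_of_ne (by decide) (by decide)) (pow_apply_eigen_of_lower _ _
        (polar_self_SigmaT (by decide)) hW j) i) r
  have hz : ∀ u i : ℕ, (u : ℂ) - i - r = 0 ↔ r + i = u := by
    intro u i
    rw [sub_sub, sub_eq_zero]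
    norm_cast
    omega
  by_cases hu : r + i = u
  · by_cases hw : r + j = w
    · rw [(hz u i).2 hu, zero_smul] at h₁
      rw [(hz w j).2 hw, zero_smul] at h₂
      rw [if_pos ⟨hu, hw⟩, evZero_eq_collapseT h₁ h₂, transvect, if_pos (by omega), hQ,
        show u - r = i by omega, show w - r = j by omega]
    · rw [if_neg (fun h => hw h.2)]
      exact evZero_eq_zero_of_eigen (by decide) (fun h => hw ((hz w j).1 h)) h₂
  · rw [if_neg (fun h => hu h.1)]
    exact evZero_eq_zero_of_eigen (by decide) (fun h => hu ((hz u i).1 h)) h₁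

lemma brackets_le_span : Subalgebra.toSubmodule brackets ≤ Submodule.span ℂ {φ | ∃ r i j : ℕ,
    φ = (X (1, 0) * X (2, 1) - X (1, 1) * X (2, 0)) ^ r *
      ((X (0, 0) * X (1, 0) + X (0, 1) * X (1, 1)) ^ i *
        (X (0, 0) * X (2, 0) + X (0, 1) * X (2, 1)) ^ j)} := by
  rw [brackets, Algebra.adjoin_eq_span]
  refine Submodule.span_mono fun φ hφ => ?_
  induction hφ using Submonoid.closure_induction with
  | one => exact ⟨0, 0, 0, by simp⟩
  | mem x hx =>
    rcases hx with rfl | rfl | rfl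
    exacts [⟨1, 0, 0, by ring⟩, ⟨0, 1, 0, by ring⟩, ⟨0, 0, 1, by ring⟩]
  | mul x y _ _ hx hy =>
    obtain ⟨r, i, j, rfl⟩ := hx
    obtain ⟨r', i', j', rfl⟩ := hy
    exact ⟨r + r', i + i', j + j', by ring⟩

lemma evZero_symb_mem_span {U W : CoordRing ν} {u w : ℕ}
    (hU : polar ν 1 1 (embT ν 1 U * embT ν 2 W) = (u : ℂ) • (embT ν 1 U * embT ν 2 W))
    (hW : polar ν 2 2 (embT ν 1 U * embT ν 2 W) = (w : ℂ) • (embT ν 1 U * embT ν 2 W))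
    {φ : Symb} (hφ : φ ∈ brackets) :
    evZero ν (symb ν φ (embT ν 1 U * embT ν 2 W)) ∈
      Submodule.span ℂ (Set.range fun r => transvect ν u w r U W) := by
  have hφ' := brackets_le_span hφ
  clear hφ
  induction hφ' using Submodule.span_induction with
  | zero => rw [map_zero, LinearMap.zero_apply, map_zero]; exact zero_mem _
  | add x y _ _ hx hy => rw [map_add, LinearMap.add_apply, map_add]; exact add_mem hx hy
  | smul r x _ hx =>
    rw [map_smul, LinearMap.smul_apply, map_smul]
    exact Submodule.smul_mem _ r hx
  | mem x hx =>
    obtain ⟨r, i, j, rfl⟩ := hx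
    have e₁ : symb ν (X (1, 0) * X (2, 1) - X (1, 1) * X (2, 0)) = OmegaT ν 1 2 := by
      simp only [map_sub, map_mul, symb_X_of_ne ν (show (1 : Fin 3) ≠ 0 by decide),
        symb_X_of_ne ν (show (2 : Fin 3) ≠ 0 by decide), OmegaT]
    have e₂ : ∀ a : Fin 3, a ≠ 0 →
        symb ν (X (0, 0) * X (a, 0) + X (0, 1) * X (a, 1)) = SigmaT ν a := by
      intro a ha
      simp only [map_add, map_mul, symb_X_of_ne ν ha]
      rw [symb_X, symb_X, symbOp, symbOp, if_pos rfl, if_pos rfl, SigmaT]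
    rw [map_mul (symb ν), map_mul (symb ν), map_pow, map_pow, map_pow, e₁, e₂ 1 (by decide),
      e₂ 2 (by decide), Module.End.mul_apply, Module.End.mul_apply, evZero_OmegaT_SigmaT hU hW]
    split_ifs
    · exact Submodule.subset_span ⟨r, rfl⟩
    · exact zero_mem _

/-- Euler's identity for the order. -/
lemma euler_order [Fintype ι] {U : CoordRing ν} {d u : ℕ}
    (hU : U.IsWeightedHomogeneous (wBi ν) (d, u)) :
    X (Sum.inr 0) * pderiv (Sum.inr 0) U + X (Sum.inr 1) * pderiv (Sum.inr 1) U = (u : ℂ) • U := by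
  have h : U.IsWeightedHomogeneous (fun v => (wBi ν v).2) u := by
    intro s hs
    have h₁ : (Finsupp.weight (wBi ν) s).2 = u := by rw [hU hs]
    rw [Finsupp.weight_apply] at h₁ ⊢
    rw [← h₁, Finsupp.sum, Finsupp.sum, Prod.snd_sum]
    rfl
  have h₂ := h.sum_weight_X_mul_pderiv
  rw [Fintype.sum_sum_type] at h₂
  simpa [wBi, Fin.sum_univ_two, nsmul_eq_mul, smul_eq_C_mul] using h₂

lemma isWeightedHomogeneous_prod_pow {p : ℕ} {f : Fin p → CoordRing ν} {d a : Fin p → ℕ}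
    (hf : ∀ i, (f i).IsWeightedHomogeneous (wBi ν) (d i, a i)) (α : Fin p → ℕ) :
    (∏ i, f i ^ α i).IsWeightedHomogeneous (wBi ν) (∑ i, α i * d i, ∑ i, α i * a i) := by
  have h := IsWeightedHomogeneous.prod Finset.univ (fun i => f i ^ α i)
    (fun i => α i • (d i, a i)) (fun i _ => (hf i).pow (α i))
  convert h using 1
  ext <;> simp [Prod.fst_sum, Prod.snd_sum]

section Joint

variable {ι₁ ι₂ : Type} {n : ι₁ → ℕ} {m : ι₂ → ℕ}

lemma polar_one_tens [Fintype ι₁] {U : CoordRing n} (W : CoordRing m) {d u : ℕ}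
    (hU : U.IsWeightedHomogeneous (wBi n) (d, u)) :
    polar _ 1 1 (tens n m U W) = (u : ℂ) • tens n m U W := by
  have h := congrArg (fun p => embT _ 1 (embL n m p)) (euler_order hU)
  simp only [map_add, map_mul, map_smul] at h
  have hX : ∀ i : Fin 2, embT _ 1 (embL n m (X (Sum.inr i))) = X (Sum.inr (1, i)) := fun i => by
    simp [embT, embL]
  rw [hX, hX] at h
  rw [Derivation.leibniz, polar_apply, polar_apply]
  simp only [pderiv_embT_self, pderiv_embT_of_ne (show (1 : Fin 3) ≠ 2 by decide), pderiv_embL]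
  rw [h]
  simp only [smul_eq_mul, mul_zero, add_zero, zero_add, mul_smul_comm]
  rw [mul_comm]

lemma polar_two_tens [Fintype ι₂] (U : CoordRing n) {W : CoordRing m} {e w : ℕ}
    (hW : W.IsWeightedHomogeneous (wBi m) (e, w)) :
    polar _ 2 2 (tens n m U W) = (w : ℂ) • tens n m U W := by
  have h := congrArg (fun p => embT _ 2 (embR n m p)) (euler_order hW)
  simp only [map_add, map_mul, map_smul] at h
  have hX : ∀ i : Fin 2, embT _ 2 (embR n m (X (Sum.inr i))) = X (Sum.inr (2, i)) := fun i => by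
    simp [embT, embR]
  rw [hX, hX] at h
  rw [Derivation.leibniz, polar_apply, polar_apply]
  simp only [pderiv_embT_self, pderiv_embT_of_ne (show (2 : Fin 3) ≠ 1 by decide), pderiv_embR]
  rw [h]
  simp only [smul_eq_mul, mul_zero, add_zero, mul_smul_comm]

end Joint

end Transvectants

/-- **Generation of joint covariants by transvectants of monomials.** Let
`V₁ = ⊕ i, S_{n i}` and `V₂ = ⊕ j, S_{m j}` be spaces of binary forms and let
`A = {f 0, …, f (p-1)} ⊂ Cov(V₁)` and `B = {g 0, …, g (q-1)} ⊂ Cov(V₂)` be finite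
generating sets of homogeneous covariants (of bidegrees `(d i, a i)` and
`(e j, b j)` respectively). Then `Cov(V₁ ⊕ V₂)` is generated as a `ℂ`-algebra by
the transvectants `⟨U, W⟩_r`, where `r` ranges over the nonnegative integers and
`U`, `W` range over the monomials in `A` and `B` respectively. -/
theorem joint_covariants_generated_by_transvectants
    (s t : ℕ) (n : Fin s → ℕ) (m : Fin t → ℕ)
    (p q : ℕ) (f : Fin p → CoordRing n) (g : Fin q → CoordRing m)
    (d a : Fin p → ℕ) (e b : Fin q → ℕ)
    (hfc : ∀ i, f i ∈ Covariants n) (hgc : ∀ j, g j ∈ Covariants m)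
    (hfh : ∀ i, (f i).IsWeightedHomogeneous (wBi n) (d i, a i))
    (hgh : ∀ j, (g j).IsWeightedHomogeneous (wBi m) (e j, b j))
    (hfgen : Covariants n = Algebra.adjoin ℂ (Set.range f))
    (hggen : Covariants m = Algebra.adjoin ℂ (Set.range g)) :
    Covariants (Sum.elim n m) = Algebra.adjoin ℂ
      {h | ∃ (α : Fin p → ℕ) (β : Fin q → ℕ) (r : ℕ),
        h = transvect (Sum.elim n m) (∑ i, α i * a i) (∑ j, β j * b j) r
              (embL n m (∏ i, f i ^ α i)) (embR n m (∏ j, g j ^ β j))} := by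
  have hU : ∀ α : Fin p → ℕ, ∏ i, f i ^ α i ∈ Covariants n := fun α =>
    prod_mem fun i _ => pow_mem (hfc i) _
  have hW : ∀ β : Fin q → ℕ, ∏ j, g j ^ β j ∈ Covariants m := fun β =>
    prod_mem fun j _ => pow_mem (hgc j) _
  refine le_antisymm (fun P hP => ?_) (Algebra.adjoin_le ?_)
  · have hP' : P ∈ (⊤ : Submodule ℂ (CoordRing (Sum.elim n m))) := trivial
    rw [← span_symb_eq_top n m f g hfgen hggen, Submodule.mem_span_set'] at hP'
    obtain ⟨k, z, h, hsum⟩ := hP'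
    choose α β φ hφ using fun i => (h i).2
    have hS : ∀ i, tens n m (∏ l, f l ^ α i l) (∏ l, g l ^ β i l) ∈ InvT (Sum.elim n m) :=
      fun i => tens_mem_InvT (hU _) (hW _)
    have hsum' : ∑ i, evZero _ (symb _ (z i • φ i)
        (tens n m (∏ l, f l ^ α i l) (∏ l, g l ^ β i l))) = P := by
      rw [← hsum]
      refine Finset.sum_congr rfl fun i _ => ?_
      rw [map_smul, LinearMap.smul_apply, map_smul, hφ i]
    rw [← hsum', ← sum_evZero_haar _ _ _ hS (by rwa [hsum'])]
    refine sum_mem fun i _ => ?_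
    have hmem := evZero_symb_mem_span
      (polar_one_tens _ (isWeightedHomogeneous_prod_pow hfh (α i)))
      (polar_two_tens _ (isWeightedHomogeneous_prod_pow hgh (β i))) (haar_genAct_mem (z i • φ i))
    refine (Subalgebra.mem_toSubmodule _).1 (Submodule.span_le.2 ?_ hmem)
    rintro _ ⟨r, rfl⟩
    exact Algebra.subset_adjoin ⟨α i, β i, r, rfl⟩
  · rintro _ ⟨α, β, r, rfl⟩
    exact transvect_mem_Covariants (embL_mem_Covariants n m (hU α))
      (embR_mem_Covariants n m (hW β)) _ _ r
end
end
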